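/- arXiv:2307.02387 — 6 statements merged into one kernel-verified Lean document; each statement's English description precedes it below -/
import Mathlib

section
/- Let ℓ > 0 and T > 0. Let v ∈ C¹([0,ℓ]) with v(x) < 0 for all x ∈ [0,ℓ], and let φ ∈ C¹([0,ℓ]×[0,T]) with φ(ℓ,0) = 0. Then there exists exactly one function w ∈ C¹([0,ℓ]×[0,T]) such that ∂_t w(x,t) + ∂_x(v(x) w(x,t)) = −φ(x,t) for all (x,t) ∈ [0,ℓ]×[0,T], w(ℓ,t) = 0 for all t ∈ [0,T], and w(x,0) = 0 for all x ∈ [0,ℓ]. -/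
open Set

/-- `IsTransportSol ℓ T v φ w` says that `w` is a classical (C¹) solution on the closed
rectangle `[0,ℓ] × [0,T]` of the transport equation `∂ₜ w + ∂ₓ (v w) = -φ`
(with `∂ₓ (v w) = v' w + v ∂ₓ w`), with boundary condition `w(ℓ,t) = 0` at the inflow end
and initial condition `w(x,0) = 0`. -/
def IsTransportSol (ℓ T : ℝ) (v : ℝ → ℝ) (φ : ℝ → ℝ → ℝ) (w : ℝ → ℝ → ℝ) : Prop :=
  ContDiffOn ℝ 1 (fun p : ℝ × ℝ => w p.1 p.2) (Icc 0 ℓ ×ˢ Icc 0 T) ∧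
  (∀ x ∈ Icc 0 ℓ, ∀ t ∈ Icc 0 T,
    derivWithin (fun τ => w x τ) (Icc 0 T) t
      + (derivWithin v (Icc 0 ℓ) x * w x t + v x * derivWithin (fun y => w y t) (Icc 0 ℓ) x)
      = - φ x t) ∧
  (∀ t ∈ Icc 0 T, w ℓ t = 0) ∧
  (∀ x ∈ Icc 0 ℓ, w x 0 = 0)

open Filter Topology MeasureTheory

/-- Differentiation under the integral sign for an integrand that is continuous together with its
partial derivative. -/
theorem hasDerivAt_intervalIntegral_of_continuous {F F' : ℝ → ℝ → ℝ}
    (hF : Continuous (fun p : ℝ × ℝ => F p.1 p.2))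
    (hF' : Continuous (fun p : ℝ × ℝ => F' p.1 p.2))
    (hd : ∀ d τ, HasDerivAt (fun y => F y τ) (F' d τ) d) (a b d : ℝ) :
    HasDerivAt (fun y => ∫ τ in a..b, F y τ) (∫ τ in a..b, F' d τ) d := by
  have hK : IsCompact (Icc (d - 1) (d + 1) ×ˢ uIcc a b) := isCompact_Icc.prod isCompact_uIcc
  obtain ⟨C, hC⟩ := hK.exists_bound_of_continuousOn hF'.continuousOn
  have hcF : ∀ y, Continuous (F y) := fun y => hF.comp (by fun_prop : Continuous fun τ => (y, τ))
  have hcF' : ∀ y, Continuous (F' y) := fun y => hF'.comp (by fun_prop : Continuous fun τ => (y, τ))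
  refine (intervalIntegral.hasDerivAt_integral_of_dominated_loc_of_deriv_le
    (s := Icc (d - 1) (d + 1)) (bound := fun _ => C) (Icc_mem_nhds (by linarith) (by linarith))
    (Eventually.of_forall fun y => (hcF y).aestronglyMeasurable)
    ((hcF d).intervalIntegrable _ _) (hcF' d).aestronglyMeasurable ?_
    intervalIntegrable_const ?_).2
  · exact Eventually.of_forall fun τ hτ y hy => hC (y, τ) ⟨hy, uIoc_subset_uIcc hτ⟩
  · exact Eventually.of_forall fun τ _ y _ => hd y τ

/-- A function of two real variables with continuous partial derivatives is `C¹`. -/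
theorem contDiff_one_of_continuous_partials {f f₁ f₂ : ℝ → ℝ → ℝ}
    (h₁ : Continuous (fun p : ℝ × ℝ => f₁ p.1 p.2))
    (h₂ : Continuous (fun p : ℝ × ℝ => f₂ p.1 p.2))
    (d₁ : ∀ x y, HasDerivAt (fun z => f z y) (f₁ x y) x)
    (d₂ : ∀ x y, HasDerivAt (fun z => f x z) (f₂ x y) y) :
    ContDiff ℝ 1 (fun p : ℝ × ℝ => f p.1 p.2) := by
  have c₁ : Continuous fun p : ℝ × ℝ => ContinuousLinearMap.toSpanSingleton ℝ (f₁ p.1 p.2) :=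
    (ContinuousLinearMap.toSpanSingletonCLE (𝕜 := ℝ) (E := ℝ)).continuous.comp h₁
  have c₂ : Continuous fun p : ℝ × ℝ => ContinuousLinearMap.toSpanSingleton ℝ (f₂ p.1 p.2) :=
    (ContinuousLinearMap.toSpanSingletonCLE (𝕜 := ℝ) (E := ℝ)).continuous.comp h₂
  refine contDiff_one_iff_hasFDerivAt.2 ⟨fun p =>
    (ContinuousLinearMap.toSpanSingleton ℝ (f₁ p.1 p.2)).coprod
      (ContinuousLinearMap.toSpanSingleton ℝ (f₂ p.1 p.2)), ?_, fun p => ?_⟩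
  · have : Continuous fun q : (ℝ →L[ℝ] ℝ) × (ℝ →L[ℝ] ℝ) => q.1.coprod q.2 :=
      (ContinuousLinearMap.coprodEquivL ℝ (E := ℝ) (F := ℝ) (G := ℝ)).continuous
    exact this.comp (c₁.prodMk c₂)
  · exact (hasStrictFDerivAt_uncurry_coprod (u := p) (f := f)
      (f₁ := fun x y => ContinuousLinearMap.toSpanSingleton ℝ (f₁ x y))
      (f₂ := fun x y => ContinuousLinearMap.toSpanSingleton ℝ (f₂ x y))
      (Eventually.of_forall fun q => (d₁ q.1 q.2).hasFDerivAt)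
      (Eventually.of_forall fun q => (d₂ q.1 q.2).hasFDerivAt)
      c₁.continuousAt c₂.continuousAt).hasFDerivAt

/-- The travel-time coordinate `σ` of a bounded negative velocity field, with its inverse `X`,
which is the characteristic flow. -/
theorem exists_travel_time {v : ℝ → ℝ} (hv : Continuous v) (hneg : ∀ x, v x < 0) {M : ℝ}
    (hM : ∀ x, -M ≤ v x) (x₀ : ℝ) :
    ∃ σ X : ℝ → ℝ, σ x₀ = 0 ∧ StrictAnti σ ∧ (∀ x, HasDerivAt σ (v x)⁻¹ x) ∧
      (∀ s, σ (X s) = s) ∧ (∀ x, X (σ x) = x) ∧ ∀ s, HasDerivAt X (v (X s)) s := by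
  have hMpos : 0 < M := by linarith [hneg 0, hM 0]
  have hinv : Continuous fun x => (v x)⁻¹ := hv.inv₀ fun x => (hneg x).ne
  set θ : ℝ → ℝ := fun x => ∫ y in x₀..x, -(v y)⁻¹ with hθ
  have hθd : ∀ x, HasDerivAt θ (-(v x)⁻¹) x := fun x =>
    (hinv.neg.integral_hasStrictDerivAt x₀ x).hasDerivAt
  have hlow : ∀ x, M⁻¹ ≤ deriv θ x := fun x => by
    rw [(hθd x).deriv, ← inv_neg]
    exact inv_anti₀ (by linarith [hneg x]) (by linarith [hM x])
  have hdiff : Differentiable ℝ θ := fun x => (hθd x).differentiableAt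
  have hmono : StrictMono θ := strictMono_of_deriv_pos fun x =>
    lt_of_lt_of_le (inv_pos.2 hMpos) (hlow x)
  have hexp : ∀ ⦃x y⦄, x ≤ y → M⁻¹ * (y - x) ≤ θ y - θ x :=
    mul_sub_le_image_sub_of_le_deriv hdiff hlow
  have hθ0 : θ x₀ = 0 := by simp [hθ]
  have hlin : Tendsto (fun x => M⁻¹ * (x - x₀)) atTop atTop :=
    (tendsto_atTop_add_const_right _ _ tendsto_id).const_mul_atTop (inv_pos.2 hMpos)
  have hlin' : Tendsto (fun x => M⁻¹ * (x - x₀)) atBot atBot :=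
    (tendsto_atBot_add_const_right _ _ tendsto_id).const_mul_atBot (inv_pos.2 hMpos)
  have hsurj : Function.Surjective θ := by
    refine hdiff.continuous.surjective ?_ ?_
    · refine tendsto_atTop_mono' _ ?_ hlin
      filter_upwards [eventually_ge_atTop x₀] with x hx
      linarith [hexp hx]
    · refine tendsto_atBot_mono' _ ?_ hlin'
      filter_upwards [eventually_le_atBot x₀] with x hx
      linarith [hexp hx]
  set e := hmono.orderIsoOfSurjective θ hsurj with he
  have hc : Continuous e.symm := e.symm.continuous
  have her : ∀ s, θ (e.symm s) = s := fun s => e.apply_symm_apply s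
  have hel : ∀ x, e.symm (θ x) = x := fun x => e.symm_apply_apply x
  refine ⟨fun x => -θ x, fun s => e.symm (-s), by simp [hθ0], hmono.neg, fun x => ?_,
    fun s => by simp [her], fun x => by simp [hel], fun s => ?_⟩
  · simpa using! (hθd x).neg
  · have h := HasDerivAt.of_local_left_inverse (f := θ) (g := e.symm) (a := -s)
      hc.continuousAt (hθd _) (by simpa using (hneg _).ne) (Eventually.of_forall her)
    simpa [Function.comp_def] using h.scomp s (hasDerivAt_neg s)

/-- A function of class `C¹` on a rectangle extends to a continuous function on the plane which
is continuously differentiable in the first variable. -/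
theorem exists_extension_contDiff_fst {a b c e : ℝ} (hab : a < b) (hce : c < e)
    {q : ℝ × ℝ → ℝ} (hq : ContDiffOn ℝ 1 q (Icc a b ×ˢ Icc c e)) :
    ∃ Q Q' : ℝ → ℝ → ℝ, Continuous (fun p : ℝ × ℝ => Q p.1 p.2) ∧
      Continuous (fun p : ℝ × ℝ => Q' p.1 p.2) ∧
      (∀ x t, HasDerivAt (fun y => Q y t) (Q' x t) x) ∧
      ∀ x ∈ Icc a b, ∀ t ∈ Icc c e, Q x t = q (x, t) := by
  set R : Set (ℝ × ℝ) := Icc a b ×ˢ Icc c e with hR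
  have huR : UniqueDiffOn ℝ R := (uniqueDiffOn_Icc hab).prod (uniqueDiffOn_Icc hce)
  have hg : ContinuousOn (fun p => fderivWithin ℝ q R p (1, 0)) R :=
    (hq.continuousOn_fderivWithin huR le_rfl).clm_apply continuousOn_const
  let P : ℝ × ℝ → ℝ × ℝ := fun p => (projIcc a b hab.le p.1, projIcc c e hce.le p.2)
  have hP : Continuous P :=
    (continuous_subtype_val.comp (continuous_projIcc.comp continuous_fst)).prodMk
      (continuous_subtype_val.comp (continuous_projIcc.comp continuous_snd))
  have hPR : ∀ p, P p ∈ R := fun p => ⟨(projIcc a b hab.le p.1).2, (projIcc c e hce.le p.2).2⟩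
  have hPid : ∀ p ∈ R, P p = p := fun p hp => by
    ext
    · simp [P, projIcc_of_mem hab.le hp.1]
    · simp [P, projIcc_of_mem hce.le hp.2]
  set Q' : ℝ → ℝ → ℝ := fun x t => fderivWithin ℝ q R (P (x, t)) (1, 0) with hQ'
  have hQ'c : Continuous (fun p : ℝ × ℝ => Q' p.1 p.2) := hg.comp_continuous hP hPR
  have hQ'x : ∀ t, Continuous fun x => Q' x t := fun t =>
    hQ'c.comp (by fun_prop : Continuous fun x : ℝ => (x, t))
  refine ⟨fun x t => q (P (a, t)) + ∫ y in a..x, Q' y t, Q', ?_, hQ'c, fun x t => ?_, ?_⟩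
  · refine Continuous.add ?_ ?_
    · exact hq.continuousOn.comp_continuous
        (hP.comp (by fun_prop : Continuous fun p : ℝ × ℝ => (a, p.2))) fun p => hPR _
    · exact intervalIntegral.continuous_parametric_intervalIntegral_of_continuous
        (f := fun (p : ℝ × ℝ) y => Q' y p.2)
        (hQ'c.comp (by fun_prop : Continuous fun z : (ℝ × ℝ) × ℝ => (z.2, z.1.2))) continuous_fst
  · exact ((hQ'x t).integral_hasStrictDerivAt a x).hasDerivAt.const_add _
  · intro x hx t ht
    have hI : ∫ y in a..x, Q' y t = q (x, t) - q (a, t) := by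
      refine intervalIntegral.integral_eq_sub_of_hasDerivAt_of_le
        (f := fun y => q (y, t)) hx.1 ?_ (fun y hy => ?_) ((hQ'x t).intervalIntegrable _ _)
      · exact hq.continuousOn.comp (by fun_prop) fun y hy => ⟨⟨hy.1, hy.2.trans hx.2⟩, ht⟩
      · have hyR : (y, t) ∈ R := ⟨⟨hy.1.le, hy.2.le.trans hx.2⟩, ht⟩
        have h1 : HasDerivWithinAt (fun y : ℝ => (y, t)) (1, 0) (Icc a b) y :=
          ((hasDerivAt_id y).prodMk (hasDerivAt_const y t)).hasDerivWithinAt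
        have h2 := ((hq.differentiableOn one_ne_zero _ hyR).hasFDerivWithinAt).comp_hasDerivWithinAt
          y h1 (fun z hz => (⟨hz, ht⟩ : (z, t) ∈ R))
        simp only [hQ', hPid _ hyR]
        exact h2.hasDerivAt (Icc_mem_nhds hy.1 (hy.2.trans_le hx.2))
    simp only [hI, hPid (a, t) ⟨left_mem_Icc.2 hab.le, ht⟩]
    ring

/-- The inhomogeneous transport equation with unit speed on the quadrant, with zero data. -/
theorem exists_unit_speed_transport {F F' : ℝ → ℝ → ℝ}
    (hF : Continuous (fun p : ℝ × ℝ => F p.1 p.2))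
    (hF' : Continuous (fun p : ℝ × ℝ => F' p.1 p.2))
    (hd : ∀ s t, HasDerivAt (fun y => F y t) (F' s t) s) (h0 : F 0 0 = 0) :
    ∃ u us ut : ℝ → ℝ → ℝ, ContDiff ℝ 1 (fun p : ℝ × ℝ => u p.1 p.2) ∧
      (∀ s t, HasDerivAt (fun y => u y t) (us s t) s) ∧
      (∀ s t, HasDerivAt (fun y => u s y) (ut s t) t) ∧
      (∀ s t, ut s t + us s t = F s t) ∧
      (∀ t, 0 ≤ t → u 0 t = 0) ∧ (∀ s, 0 ≤ s → u s 0 = 0) := by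
  set K : ℝ → ℝ → ℝ := fun d t => ∫ τ in (0 : ℝ)..t, F (d + τ) τ with hK
  set K₁ : ℝ → ℝ → ℝ := fun d t => ∫ τ in (0 : ℝ)..t, F' (d + τ) τ with hK₁
  set K₂ : ℝ → ℝ → ℝ := fun d t => F (d + t) t with hK₂
  have hK₂c : Continuous (fun p : ℝ × ℝ => K₂ p.1 p.2) :=
    hF.comp (by fun_prop : Continuous fun p : ℝ × ℝ => (p.1 + p.2, p.2))
  have hF'c : Continuous (fun p : ℝ × ℝ => F' (p.1 + p.2) p.2) :=
    hF'.comp (by fun_prop : Continuous fun p : ℝ × ℝ => (p.1 + p.2, p.2))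
  have hK₁c : Continuous (fun p : ℝ × ℝ => K₁ p.1 p.2) :=
    intervalIntegral.continuous_parametric_intervalIntegral_of_continuous
      (f := fun (p : ℝ × ℝ) τ => F' (p.1 + τ) τ)
      (hF'c.comp (by fun_prop : Continuous fun z : (ℝ × ℝ) × ℝ => (z.1.1, z.2))) continuous_snd
  have d₁ : ∀ d t, HasDerivAt (fun z => K z t) (K₁ d t) d := fun d t =>
    hasDerivAt_intervalIntegral_of_continuous hK₂c hF'c
      (fun d τ => (hd (d + τ) τ).comp_add_const d τ) 0 t d
  have d₂ : ∀ d t, HasDerivAt (fun z => K d z) (K₂ d t) t := fun d t => by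
    have hc : Continuous fun τ => F (d + τ) τ :=
      hK₂c.comp (by fun_prop : Continuous fun τ : ℝ => (d, τ))
    exact (hc.integral_hasStrictDerivAt 0 t).hasDerivAt
  have hKC := contDiff_one_of_continuous_partials hK₁c hK₂c d₁ d₂
  have dK : ∀ (α β : ℝ → ℝ) (α' β' y : ℝ), HasDerivAt α α' y → HasDerivAt β β' y →
      HasDerivAt (fun z => K (α z) (β z)) (K₁ (α y) (β y) * α' + K₂ (α y) (β y) * β') y := by
    intro α β α' β' y hα hβ
    have hf := (hKC.differentiable one_ne_zero (α y, β y)).hasFDerivAt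
    have e₁ := (d₁ (α y) (β y)).unique (HasFDerivAt.comp_hasDerivAt (f := fun z => (z, β y)) (α y) hf
      ((hasDerivAt_id (α y)).prodMk (hasDerivAt_const (α y) (β y))))
    have e₂ := (d₂ (α y) (β y)).unique (HasFDerivAt.comp_hasDerivAt (f := fun z => (α y, z)) (β y) hf
      ((hasDerivAt_const (β y) (α y)).prodMk (hasDerivAt_id (β y))))
    refine (hf.comp_hasDerivAt y (hα.prodMk hβ)).congr_deriv ?_
    rw [e₁, e₂, mul_comm _ α', mul_comm _ β', ← smul_eq_mul, ← smul_eq_mul, ← map_smul,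
      ← map_smul, ← map_add]
    simp
  -- the values of `K` on the inflow boundary `s = 0`, cut off for `0 ≤ d`
  set g' : ℝ → ℝ := fun d => K₁ d (-d) - K₂ d (-d) with hg'
  have hgd : ∀ d, HasDerivAt (fun d => K d (-d)) (g' d) d := fun d => by
    have := dK (fun d => d) (fun d => -d) 1 (-1) d (hasDerivAt_id d) (hasDerivAt_neg d)
    refine this.congr_deriv ?_
    simp only [hg']; ring
  have hg'c : Continuous g' :=
    (hK₁c.comp (by fun_prop : Continuous fun d : ℝ => (d, -d))).sub
      (hK₂c.comp (by fun_prop : Continuous fun d : ℝ => (d, -d)))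
  have hg'0 : g' 0 = 0 := by simp [hg', hK₁, hK₂, h0]
  have hmc : Continuous fun y : ℝ => g' (min y 0) := hg'c.comp (by fun_prop)
  set k : ℝ → ℝ := fun d => ∫ y in (0 : ℝ)..d, g' (min y 0) with hk
  have hkd : ∀ d, HasDerivAt k (g' (min d 0)) d := fun d =>
    (hmc.integral_hasStrictDerivAt 0 d).hasDerivAt
  have hkC : ContDiff ℝ 1 k := contDiff_one_iff_deriv.2
    ⟨fun d => (hkd d).differentiableAt, by rw [funext fun d => (hkd d).deriv]; exact hmc⟩
  have hkpos : ∀ d, 0 ≤ d → k d = 0 := fun d hd0 => by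
    refine (intervalIntegral.integral_congr (g := fun _ => 0) fun y hy => ?_).trans (by simp)
    rw [uIcc_of_le hd0] at hy
    simp [min_eq_right hy.1, hg'0]
  have hkneg : ∀ d, d ≤ 0 → k d = K d (-d) := fun d hd0 => by
    have : k d = ∫ y in (0 : ℝ)..d, g' y := intervalIntegral.integral_congr fun y hy => by
      rw [uIcc_of_ge hd0] at hy
      simp [min_eq_left hy.2]
    rw [this, intervalIntegral.integral_eq_sub_of_hasDerivAt (fun y _ => hgd y)
      (hg'c.intervalIntegrable _ _)]
    simp [hK]
  refine ⟨fun s t => K (s - t) t - k (s - t), fun s t => K₁ (s - t) t - g' (min (s - t) 0),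
    fun s t => -K₁ (s - t) t + K₂ (s - t) t + g' (min (s - t) 0), ?_, fun s t => ?_,
    fun s t => ?_, fun s t => ?_, fun t ht => ?_, fun s hs => ?_⟩
  · exact (hKC.comp ((contDiff_fst.sub contDiff_snd).prodMk contDiff_snd)).sub
      (hkC.comp (contDiff_fst.sub contDiff_snd))
  · exact ((d₁ (s - t) t).comp_sub_const s t).sub ((hkd (s - t)).comp_sub_const s t)
  · have h1 := dK (fun y => s - y) (fun y => y) (-1) 1 t ((hasDerivAt_id t).const_sub s)
      (hasDerivAt_id t)
    have h2 := (hkd (s - t)).comp t ((hasDerivAt_id t).const_sub s)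
    refine (h1.sub h2).congr_deriv ?_
    ring
  · simp only [hK₂]
    rw [sub_add_cancel]; ring
  · simp [hkneg (-t) (by linarith)]
  · simp [hkpos s hs, hK]

/-- Along a characteristic run backwards, `v w` has derivative `v φ` for a solution `w`. -/
theorem IsTransportSol.hasDerivWithinAt_characteristic {ℓ T : ℝ} (hℓ : 0 < ℓ) (hT : 0 < T)
    {v : ℝ → ℝ} (hv : ContDiffOn ℝ 1 v (Icc 0 ℓ)) {φ w : ℝ → ℝ → ℝ}
    (hw : IsTransportSol ℓ T v φ w) {α β : ℝ → ℝ} {I : Set ℝ} {r : ℝ} (hr : r ∈ I)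
    (hα : HasDerivWithinAt α (-v (α r)) I r) (hβ : HasDerivWithinAt β (-1) I r)
    (hαI : MapsTo α I (Icc 0 ℓ)) (hβI : MapsTo β I (Icc 0 T)) :
    HasDerivWithinAt (fun y => v (α y) * w (α y) (β y)) (v (α r) * φ (α r) (β r)) I r := by
  obtain ⟨hC, hpde, -, -⟩ := hw
  have hx := hαI hr
  have ht := hβI hr
  have hf := (hC.differentiableOn one_ne_zero (α r, β r) ⟨hx, ht⟩).hasFDerivWithinAt
  set L := fderivWithin ℝ (fun p : ℝ × ℝ => w p.1 p.2) (Icc 0 ℓ ×ˢ Icc 0 T) (α r, β r)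
  have e₁ : derivWithin (fun y => w y (β r)) (Icc 0 ℓ) (α r) = L (1, 0) :=
    (HasFDerivWithinAt.comp_hasDerivWithinAt (f := fun z => (z, β r)) (α r) hf
      ((hasDerivWithinAt_id (α r) (Icc 0 ℓ)).prodMk
      (hasDerivWithinAt_const (α r) (Icc 0 ℓ) (β r)))
      fun z hz => mk_mem_prod hz ht).derivWithin
        (uniqueDiffOn_Icc hℓ _ hx)
  have e₂ : derivWithin (fun y => w (α r) y) (Icc 0 T) (β r) = L (0, 1) :=
    (HasFDerivWithinAt.comp_hasDerivWithinAt (f := fun z => (α r, z)) (β r) hf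
      ((hasDerivWithinAt_const (β r) (Icc 0 T) (α r)).prodMk
      (hasDerivWithinAt_id (β r) (Icc 0 T))) fun z hz => mk_mem_prod hx hz).derivWithin
        (uniqueDiffOn_Icc hT _ ht)
  have hvd := ((hv.differentiableOn one_ne_zero _ hx).hasDerivWithinAt).comp r hα hαI
  have hwd := hf.comp_hasDerivWithinAt r (hα.prodMk hβ) fun z hz =>
    mk_mem_prod (hαI hz) (hβI hz)
  have hL : L (-v (α r), -1) = -v (α r) * L (1, 0) - L (0, 1) := by
    rw [← smul_eq_mul, ← map_smul, ← map_sub]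
    simp
  refine (hvd.mul hwd).congr_deriv ?_
  have := hpde _ hx _ ht
  rw [e₁, e₂] at this
  simp only [Function.comp_def, hL]
  linear_combination (-v (α r)) * this

/-- Well-posedness (existence and uniqueness of a classical solution) of the hyperbolic
mixed problem on an edge with inflow at `x = ℓ` (since `v < 0`), with compatibility
condition `φ(ℓ,0) = 0`. -/
theorem transport_inflow_wellposed
    (ℓ T : ℝ) (hℓ : 0 < ℓ) (hT : 0 < T)
    (v : ℝ → ℝ) (hv : ContDiffOn ℝ 1 v (Icc 0 ℓ))
    (hvneg : ∀ x ∈ Icc 0 ℓ, v x < 0)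
    (φ : ℝ → ℝ → ℝ)
    (hφ : ContDiffOn ℝ 1 (fun p : ℝ × ℝ => φ p.1 p.2) (Icc 0 ℓ ×ˢ Icc 0 T))
    (hcompat : φ ℓ 0 = 0) :
    ∃ w : ℝ → ℝ → ℝ, IsTransportSol ℓ T v φ w ∧
      ∀ w' : ℝ → ℝ → ℝ, IsTransportSol ℓ T v φ w' →
        ∀ x ∈ Icc 0 ℓ, ∀ t ∈ Icc 0 T, w' x t = w x t := by
  set vh : ℝ → ℝ := fun x => v (projIcc 0 ℓ hℓ.le x) with hvh
  have hvh_eq : ∀ x ∈ Icc 0 ℓ, vh x = v x := fun x hx => by simp [hvh, projIcc_of_mem hℓ.le hx]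
  have hvh_cont : Continuous vh := hv.continuousOn.comp_continuous
    (continuous_subtype_val.comp continuous_projIcc) fun x => (projIcc 0 ℓ hℓ.le x).2
  obtain ⟨M, hM⟩ := isCompact_Icc.exists_bound_of_continuousOn hv.continuousOn
  obtain ⟨σ, X, hσℓ, hσanti, hσd, hσX, hXσ, hXd⟩ := exists_travel_time hvh_cont
    (fun x => hvneg _ (projIcc 0 ℓ hℓ.le x).2)
    (fun x => (abs_le.1 (hM _ (projIcc 0 ℓ hℓ.le x).2)).1) ℓ
  have hXℓ : X 0 = ℓ := by rw [← hσℓ, hXσ]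
  have hσ_nonneg : ∀ x ∈ Icc 0 ℓ, 0 ≤ σ x := fun x hx => hσℓ ▸ hσanti.antitone hx.2
  have hσC : ContDiff ℝ 1 σ := contDiff_one_iff_deriv.2 ⟨fun x => (hσd x).differentiableAt, by
    rw [funext fun x => (hσd x).deriv]
    exact hvh_cont.inv₀ fun x => (hvneg _ (projIcc 0 ℓ hℓ.le x).2).ne⟩
  have hXc : Continuous X := continuous_iff_continuousAt.2 fun s => (hXd s).continuousAt
  have hℓmem : ℓ ∈ Icc 0 ℓ := right_mem_Icc.2 hℓ.le
  have h0mem : (0 : ℝ) ∈ Icc 0 T := left_mem_Icc.2 hT.le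
  obtain ⟨Q, Q', hQ, hQ', hQd, hQeq⟩ := exists_extension_contDiff_fst hℓ hT
    (q := fun p => v p.1 * φ p.1 p.2) ((hv.comp contDiffOn_fst fun p hp => hp.1).mul hφ)
  obtain ⟨u, us, ut, huC, hus, hut, hu, hu0, hu0'⟩ := exists_unit_speed_transport
    (F := fun s t => -Q (X s) t) (F' := fun s t => -(Q' (X s) t * vh (X s)))
    (hQ.comp (by fun_prop : Continuous fun p : ℝ × ℝ => (X p.1, p.2))).neg
    ((hQ'.comp (by fun_prop : Continuous fun p : ℝ × ℝ => (X p.1, p.2))).mul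
      (by fun_prop : Continuous fun p : ℝ × ℝ => vh (X p.1))).neg
    (fun s t => ((hQd (X s) t).comp s (hXd s)).neg)
    (by rw [hXℓ, hQeq ℓ hℓmem 0 h0mem, hcompat]; simp)
  have hwC : ContDiffOn ℝ 1 (fun p : ℝ × ℝ => u (σ p.1) p.2 / v p.1) (Icc 0 ℓ ×ˢ Icc 0 T) :=
    (huC.comp ((hσC.comp contDiff_fst).prodMk contDiff_snd)).contDiffOn.div
      (hv.comp contDiffOn_fst fun p hp => hp.1) fun p hp => (hvneg _ hp.1).ne
  have hsol : IsTransportSol ℓ T v φ fun x t => u (σ x) t / v x := by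
    refine ⟨hwC, fun x hx t ht => ?_, fun t ht => ?_, fun x hx => ?_⟩
    · have hvx := (hvneg x hx).ne
      have hvd := (hv.differentiableOn one_ne_zero _ hx).hasDerivWithinAt
      have hux : HasDerivWithinAt (fun y => u (σ y) t) (us (σ x) t * (vh x)⁻¹) (Icc 0 ℓ) x :=
        ((hus (σ x) t).comp x (hσd x)).hasDerivWithinAt
      have ex : derivWithin (fun y => u (σ y) t / v y) (Icc 0 ℓ) x = _ :=
        (hux.div hvd hvx).derivWithin (uniqueDiffOn_Icc hℓ _ hx)
      have et : derivWithin (fun τ => u (σ x) τ / v x) (Icc 0 T) t = _ :=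
        ((hut (σ x) t).div_const (v x)).hasDerivWithinAt.derivWithin (uniqueDiffOn_Icc hT _ ht)
      simp only [ex, et, hvh_eq x hx]
      have hF := hu (σ x) t
      rw [hXσ, hQeq x hx t ht] at hF
      field_simp
      linear_combination hF
    · simp [hσℓ, hu0 t ht.1]
    · simp [hu0' _ (hσ_nonneg x hx)]
  refine ⟨_, hsol, fun w' hw' x hx t ht => ?_⟩
  set m := min (σ x) t with hm
  have hm0 : 0 ≤ m := le_min (hσ_nonneg x hx) ht.1
  have hα : MapsTo (fun r => X (σ x - r)) (Icc 0 m) (Icc 0 ℓ) := fun r hr => by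
    constructor
    · refine hx.1.trans (hσanti.le_iff_ge.1 ?_)
      rw [hσX]; linarith [hr.1]
    · refine hσanti.le_iff_ge.1 ?_
      rw [hσX, hσℓ]; linarith [hr.2, min_le_left (σ x) t]
  have hβ : MapsTo (fun r => t - r) (Icc 0 m) (Icc 0 T) := fun r hr =>
    ⟨by linarith [hr.2, min_le_right (σ x) t], by linarith [hr.1, ht.2]⟩
  have key : ∀ z : ℝ → ℝ → ℝ, IsTransportSol ℓ T v φ z → ∀ r ∈ Icc 0 m,
      HasDerivWithinAt (fun r => v (X (σ x - r)) * z (X (σ x - r)) (t - r))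
        (v (X (σ x - r)) * φ (X (σ x - r)) (t - r)) (Icc 0 m) r := fun z hz r hr => by
    refine hz.hasDerivWithinAt_characteristic hℓ hT hv hr ?_
      ((hasDerivAt_id r).const_sub t).hasDerivWithinAt hα hβ
    have := (hXd (σ x - r)).comp r ((hasDerivAt_id r).const_sub (σ x))
    rw [hvh_eq _ (hα hr)] at this
    exact (this.congr_deriv (by ring)).hasDerivWithinAt
  have hend : ∀ z : ℝ → ℝ → ℝ, IsTransportSol ℓ T v φ z → z (X (σ x - m)) (t - m) = 0 := by
    rintro z ⟨-, -, hz, hz'⟩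
    rcases min_choice (σ x) t with h | h
    · have := hz _ (hβ (right_mem_Icc.2 hm0))
      rwa [hm, h, sub_self, hXℓ, ← h, ← hm]
    · have := hz' _ (hα (right_mem_Icc.2 hm0))
      simp only [hm, h] at this ⊢
      rwa [sub_self]
  have hconst : ∀ r ∈ Icc 0 m, _ = _ := constant_of_derivWithin_zero
    (fun r hr => ((key w' hw' r hr).sub (key _ hsol r hr)).differentiableWithinAt)
    fun r hr => by
      have hr' := Ico_subset_Icc_self hr
      have hlt := hr.1.trans_lt hr.2
      rw [((key w' hw' r hr').sub (key _ hsol r hr')).derivWithin (uniqueDiffOn_Icc hlt r hr'),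
        sub_self]
  have h := hconst m (right_mem_Icc.2 hm0)
  simp only [Pi.sub_apply, hend w' hw', hend _ hsol, sub_zero, hXσ, mul_zero] at h
  exact mul_left_cancel₀ (hvneg x hx).ne (sub_eq_zero.1 h.symm)
end

section
/- Let ℓ > 0 and T > 0. Let v ∈ C¹([0,ℓ]) with v(x) > 0 for all x ∈ [0,ℓ], let φ ∈ C¹([0,ℓ]×[0,T]) with φ(0,0) = 0, and let g ∈ C¹([0,T]) with g(0) = 0 and g'(0) = 0. Then there exists exactly one function w ∈ C¹([0,ℓ]×[0,T]) such that ∂_t w(x,t) + ∂_x(v(x) w(x,t)) = −φ(x,t) for all (x,t) ∈ [0,ℓ]×[0,T], w(0,t) = g(t) for all t ∈ [0,T], and w(x,0) = 0 for all x ∈ [0,ℓ]. -/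
open Set

/-- `IsTransportSolOutflow ℓ T v φ g w` says that `w` is a classical (C¹) solution on the
closed rectangle `[0,ℓ] × [0,T]` of the transport equation `∂ₜ w + ∂ₓ (v w) = -φ`
(with `∂ₓ (v w) = v' w + v ∂ₓ w`), with boundary condition `w(0,t) = g(t)` at the inflow
end `x = 0` (since `v > 0`) and initial condition `w(x,0) = 0`. -/
def IsTransportSolOutflow (ℓ T : ℝ) (v : ℝ → ℝ) (φ : ℝ → ℝ → ℝ) (g : ℝ → ℝ)
    (w : ℝ → ℝ → ℝ) : Prop :=
  ContDiffOn ℝ 1 (fun p : ℝ × ℝ => w p.1 p.2) (Icc 0 ℓ ×ˢ Icc 0 T) ∧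
  (∀ x ∈ Icc 0 ℓ, ∀ t ∈ Icc 0 T,
    derivWithin (fun τ => w x τ) (Icc 0 T) t
      + (derivWithin v (Icc 0 ℓ) x * w x t + v x * derivWithin (fun y => w y t) (Icc 0 ℓ) x)
      = - φ x t) ∧
  (∀ t ∈ Icc 0 T, w 0 t = g t) ∧
  (∀ x ∈ Icc 0 ℓ, w x 0 = 0)

/-- A continuously differentiable function on a rectangle extends to a continuous function on the
plane with continuous partial derivative in the second variable. -/
theorem exists_extension_snd {ℓ T : ℝ} (hℓ : 0 < ℓ) (hT : 0 < T) {f : ℝ × ℝ → ℝ}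
    (hf : ContDiffOn ℝ 1 f (Icc 0 ℓ ×ˢ Icc 0 T)) :
    ∃ F F' : ℝ → ℝ → ℝ, Continuous (fun p : ℝ × ℝ => F p.1 p.2) ∧
      Continuous (fun p : ℝ × ℝ => F' p.1 p.2) ∧ (∀ x t, HasDerivAt (F x) (F' x t) t) ∧
      ∀ x ∈ Icc 0 ℓ, ∀ t ∈ Icc 0 T, F x t = f (x, t) := by
  have hu := (uniqueDiffOn_Icc hℓ).prod (uniqueDiffOn_Icc hT)
  set R := Icc 0 ℓ ×ˢ Icc 0 T
  set π : ℝ → ℝ := fun x => projIcc 0 ℓ hℓ.le x with hπ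
  set ρ : ℝ → ℝ := fun t => projIcc 0 T hT.le t with hρ
  have cπ : Continuous π := continuous_subtype_val.comp continuous_projIcc
  have cρ : Continuous ρ := continuous_subtype_val.comp continuous_projIcc
  have mπ : ∀ x, π x ∈ Icc 0 ℓ := fun x => (projIcc 0 ℓ hℓ.le x).2
  have mρ : ∀ x, ρ x ∈ Icc 0 T := fun x => (projIcc 0 T hT.le x).2
  have eπ : ∀ x ∈ Icc 0 ℓ, π x = x := fun x hx => by simp [hπ, projIcc_of_mem hℓ.le hx]
  have eρ : ∀ x ∈ Icc 0 T, ρ x = x := fun x hx => by simp [hρ, projIcc_of_mem hT.le hx]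
  have h0T : (0 : ℝ) ∈ Icc 0 T := ⟨le_rfl, hT.le⟩
  have cD : Continuous (fun p : ℝ × ℝ => fderivWithin ℝ f R (π p.1, ρ p.2) (0, 1)) :=
    ((hf.continuousOn_fderivWithin hu le_rfl).comp_continuous
      (by fun_prop : Continuous fun p : ℝ × ℝ => (π p.1, ρ p.2))
      fun p => ⟨mπ _, mρ _⟩).clm_apply continuous_const
  have cf : Continuous (fun p : ℝ × ℝ => f (π p.1, 0)) :=
    hf.continuousOn.comp_continuous (by fun_prop : Continuous fun p : ℝ × ℝ => (π p.1, (0 : ℝ)))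
      fun p => ⟨mπ _, h0T⟩
  have cDx : ∀ x, Continuous fun t => fderivWithin ℝ f R (π x, ρ t) (0, 1) := fun x =>
    cD.comp (by fun_prop : Continuous fun t : ℝ => (x, t))
  refine ⟨fun x t => f (π x, 0) + ∫ τ in (0 : ℝ)..t, fderivWithin ℝ f R (π x, ρ τ) (0, 1),
    fun x t => fderivWithin ℝ f R (π x, ρ t) (0, 1), ?_, cD, ?_, ?_⟩
  · refine cf.add (intervalIntegral.continuous_parametric_intervalIntegral_of_continuous
      (f := fun (p : ℝ × ℝ) τ => fderivWithin ℝ f R (π p.1, ρ τ) (0, 1)) ?_ continuous_snd)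
    exact cD.comp (by fun_prop : Continuous fun q : (ℝ × ℝ) × ℝ => (q.1.1, q.2))
  · intro x t
    exact ((cDx x).integral_hasStrictDerivAt 0 t).hasDerivAt.const_add _
  · intro x hx t ht
    have key : ∫ τ in (0 : ℝ)..t, fderivWithin ℝ f R (π x, ρ τ) (0, 1) = f (x, t) - f (x, 0) := by
      refine intervalIntegral.integral_eq_sub_of_hasDerivAt_of_le (f := fun τ => f (x, τ)) ht.1
        ?_ ?_ ((cDx x).intervalIntegrable _ _)
      · exact hf.continuousOn.comp (by fun_prop) fun τ hτ => ⟨hx, hτ.1, hτ.2.trans ht.2⟩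
      · intro τ hτ
        have hτ' : τ ∈ Icc 0 T := ⟨hτ.1.le, hτ.2.le.trans ht.2⟩
        have h1 := ((hf.differentiableOn one_ne_zero) (x, τ) ⟨hx, hτ'⟩).hasFDerivWithinAt
        have h2 : HasDerivWithinAt (fun s : ℝ => (x, s)) ((0 : ℝ), (1 : ℝ)) (Icc 0 T) τ :=
          ((hasDerivAt_const τ x).prodMk (hasDerivAt_id τ)).hasDerivWithinAt
        have h3 := h1.comp_hasDerivWithinAt τ h2 fun s hs => ⟨hx, hs⟩
        rw [eπ x hx, eρ τ hτ']
        exact h3.hasDerivAt (Icc_mem_nhds hτ.1 (hτ.2.trans_le ht.2))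
    simp only [key]
    rw [eπ x hx, add_sub_cancel]

/-- The travel time `∫₀ˣ 1 / v` of a positive velocity `v`, extended to the real line, together
with the derivatives of it and of its inverse. -/
theorem exists_travelTime {ℓ : ℝ} (hℓ : 0 ≤ ℓ) {v : ℝ → ℝ} (hv : ContinuousOn v (Icc 0 ℓ))
    (hvpos : ∀ x ∈ Icc 0 ℓ, 0 < v x) :
    ∃ (a : ℝ ≃o ℝ) (c : ℝ → ℝ), a 0 = 0 ∧ Continuous c ∧ (∀ x, 0 < c x) ∧
      (∀ x ∈ Icc 0 ℓ, c x = v x) ∧ (∀ x, HasDerivAt a (c x)⁻¹ x) ∧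
      ∀ r, HasDerivAt a.symm (c (a.symm r)) r := by
  set c : ℝ → ℝ := fun x => v (projIcc 0 ℓ hℓ x) with hc
  have cc : Continuous c := hv.comp_continuous
    (continuous_subtype_val.comp continuous_projIcc) fun x => (projIcc 0 ℓ hℓ x).2
  have cpos : ∀ x, 0 < c x := fun x => hvpos _ (projIcc 0 ℓ hℓ x).2
  have ci : Continuous fun x => (c x)⁻¹ := cc.inv₀ fun x => (cpos x).ne'
  obtain ⟨M, hM⟩ := isCompact_Icc.bddAbove_image hv
  have cM : ∀ x, c x ≤ M := fun x => hM ⟨_, (projIcc 0 ℓ hℓ x).2, rfl⟩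
  have Mpos : 0 < M := (cpos 0).trans_le (cM 0)
  set A : ℝ → ℝ := fun x => ∫ y in (0 : ℝ)..x, (c y)⁻¹ with hA
  have dA : ∀ x, HasDerivAt A (c x)⁻¹ x := fun x =>
    (ci.integral_hasStrictDerivAt 0 x).hasDerivAt
  have A0 : A 0 = 0 := by simp [hA]
  have mono : StrictMono A := strictMono_of_deriv_pos fun x => by
    rw [(dA x).deriv]; exact inv_pos.2 (cpos x)
  have dB : ∀ x, HasDerivAt (fun x => A x - M⁻¹ * x) ((c x)⁻¹ - M⁻¹ * 1) x := fun x =>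
    (dA x).sub ((hasDerivAt_id x).const_mul _)
  have monoB : Monotone fun x => A x - M⁻¹ * x :=
    monotone_of_deriv_nonneg (fun x => (dB x).differentiableAt) fun x => by
      rw [(dB x).deriv, mul_one, sub_nonneg]
      exact inv_anti₀ (cpos x) (cM x)
  have Acont : Continuous A := continuous_iff_continuousAt.2 fun x => (dA x).continuousAt
  have surj : Function.Surjective A := by
    refine Acont.surjective ?_ ?_
    · refine Filter.tendsto_atTop_mono' _ ?_ (Filter.tendsto_id.const_mul_atTop (inv_pos.2 Mpos))
      filter_upwards [Filter.eventually_ge_atTop 0] with x hx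
      have := monoB hx
      simp only [A0] at this
      simp only [id]
      linarith
    · refine Filter.tendsto_atBot_mono' _ ?_ (Filter.tendsto_id.const_mul_atBot (inv_pos.2 Mpos))
      filter_upwards [Filter.eventually_le_atBot 0] with x hx
      have := monoB hx
      simp only [A0] at this
      simp only [id]
      linarith
  refine ⟨mono.orderIsoOfSurjective A surj, c, A0, cc, cpos, fun x hx => ?_, dA, fun r => ?_⟩
  · simp [hc, projIcc_of_mem hℓ hx]
  · set a := mono.orderIsoOfSurjective A surj
    have := HasDerivAt.of_local_left_inverse (f := a) (g := a.symm) (a := r)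
      a.symm.continuous.continuousAt (dA (a.symm r)) (inv_ne_zero (cpos _).ne')
      (Filter.Eventually.of_forall fun y => a.apply_symm_apply y)
    simpa using this

/-- The primitive `(x, r) ↦ ∫₀ˣ Ψ(y, r) dy` of a continuous function with continuous partial
derivative in `r` is continuously differentiable, with the expected partial derivatives. -/
theorem contDiff_integral_param {Ψ Ψ' : ℝ → ℝ → ℝ}
    (hΨ : Continuous fun p : ℝ × ℝ => Ψ p.1 p.2) (hΨ' : Continuous fun p : ℝ × ℝ => Ψ' p.1 p.2)
    (hd : ∀ x r, HasDerivAt (Ψ x) (Ψ' x r) r) :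
    ContDiff ℝ 1 (fun p : ℝ × ℝ => ∫ y in (0 : ℝ)..p.1, Ψ y p.2) ∧
    ∀ p : ℝ × ℝ, HasFDerivAt (fun p : ℝ × ℝ => ∫ y in (0 : ℝ)..p.1, Ψ y p.2)
      ((ContinuousLinearMap.toSpanSingleton ℝ (Ψ p.1 p.2)).coprod
        (ContinuousLinearMap.toSpanSingleton ℝ (∫ y in (0 : ℝ)..p.1, Ψ' y p.2))) p := by
  have c1 : ∀ s, Continuous fun y => Ψ y s := fun s =>
    hΨ.comp (by fun_prop : Continuous fun y : ℝ => (y, s))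
  have c2 : ∀ s, Continuous fun y => Ψ' y s := fun s =>
    hΨ'.comp (by fun_prop : Continuous fun y : ℝ => (y, s))
  have c3 : Continuous fun p : ℝ × ℝ => ∫ y in (0 : ℝ)..p.1, Ψ' y p.2 :=
    intervalIntegral.continuous_parametric_intervalIntegral_of_continuous
      (f := fun (p : ℝ × ℝ) y => Ψ' y p.2)
      (hΨ'.comp (by fun_prop : Continuous fun q : (ℝ × ℝ) × ℝ => (q.2, q.1.2))) continuous_fst
  have cspan : Continuous fun z : ℝ => ContinuousLinearMap.toSpanSingleton ℝ z :=
    (ContinuousLinearMap.toSpanSingletonCLE (𝕜 := ℝ) (E := ℝ)).continuous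
  have key : ∀ p : ℝ × ℝ, HasFDerivAt (fun p : ℝ × ℝ => ∫ y in (0 : ℝ)..p.1, Ψ y p.2)
      ((ContinuousLinearMap.toSpanSingleton ℝ (Ψ p.1 p.2)).coprod
        (ContinuousLinearMap.toSpanSingleton ℝ (∫ y in (0 : ℝ)..p.1, Ψ' y p.2))) p := by
    intro p
    refine (hasStrictFDerivAt_uncurry_coprod (u := p)
      (f := fun x r => ∫ y in (0 : ℝ)..x, Ψ y r)
      (f₁ := fun x r => ContinuousLinearMap.toSpanSingleton ℝ (Ψ x r))
      (f₂ := fun x r => ContinuousLinearMap.toSpanSingleton ℝ (∫ y in (0 : ℝ)..x, Ψ' y r))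
      (Filter.Eventually.of_forall fun q => ?_) (Filter.Eventually.of_forall fun q => ?_)
      (cspan.comp hΨ).continuousAt (cspan.comp c3).continuousAt).hasFDerivAt
    · exact ((c1 q.2).integral_hasStrictDerivAt 0 q.1).hasDerivAt.hasFDerivAt
    · obtain ⟨x, r⟩ := q
      obtain ⟨C, hC⟩ := ((isCompact_uIcc (a := 0) (b := x)).prod
        (isCompact_Icc (a := r - 1) (b := r + 1))).exists_bound_of_continuousOn hΨ'.continuousOn
      refine (intervalIntegral.hasDerivAt_integral_of_dominated_loc_of_deriv_le
        (F := fun s y => Ψ y s) (F' := fun s y => Ψ' y s) (bound := fun _ => C)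
        (Icc_mem_nhds (sub_one_lt r) (lt_add_one r))
        (Filter.Eventually.of_forall fun s => (c1 s).aestronglyMeasurable)
        ((c1 r).intervalIntegrable _ _) (c2 r).aestronglyMeasurable
        (Filter.Eventually.of_forall fun y hy s hs => hC (y, s) ⟨uIoc_subset_uIcc hy, hs⟩)
        intervalIntegrable_const
        (Filter.Eventually.of_forall fun y _ s _ => hd y s)).2.hasFDerivAt
  exact ⟨contDiff_one_iff_hasFDerivAt.2
    ⟨_, (ContinuousLinearMap.coprodEquivL (S := ℝ)).continuous.comp
      ((cspan.comp hΨ).prodMk (cspan.comp c3)), key⟩, key⟩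

/-- Gluing two differentiable functions at a point where values and derivatives agree. -/
theorem hasDerivAt_ite_le {f g f' g' : ℝ → ℝ} {b : ℝ} (hf : ∀ r, HasDerivAt f (f' r) r)
    (hg : ∀ r, HasDerivAt g (g' r) r) (h : f b = g b) (h' : f' b = g' b) (r : ℝ) :
    HasDerivAt (fun r => if r ≤ b then f r else g r) (if r ≤ b then f' r else g' r) r := by
  rcases lt_trichotomy r b with hr | rfl | hr
  · rw [if_pos hr.le]
    refine (hf r).congr_of_eventuallyEq ?_
    filter_upwards [Iio_mem_nhds hr] with s hs
    exact if_pos (le_of_lt hs)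
  · rw [if_pos le_rfl, ← hasDerivWithinAt_univ, ← Iic_union_Ici (a := r)]
    refine HasDerivWithinAt.union ?_ ?_
    · exact (hf r).hasDerivWithinAt.congr (fun s hs => if_pos hs) (if_pos le_rfl)
    · rw [h']
      refine (hg r).hasDerivWithinAt.congr (fun s hs => ?_) (by simp [h])
      rcases eq_or_lt_of_le (mem_Ici.1 hs) with rfl | hs
      · simp [h]
      · exact if_neg hs.not_ge
  · rw [if_neg hr.not_ge]
    refine (hg r).congr_of_eventuallyEq ?_
    filter_upwards [Ioi_mem_nhds hr] with s hs
    exact if_neg (not_le_of_gt hs)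

/-- Along a characteristic `t = γ(y)`, `γ' = 1 / v`, the flux `v w` of a solution has
derivative `-φ`. -/
theorem IsTransportSolOutflow.hasDerivWithinAt_flux {ℓ T : ℝ} {v g γ : ℝ → ℝ} {φ w : ℝ → ℝ → ℝ}
    (hw : IsTransportSolOutflow ℓ T v φ g w) (hℓ : 0 < ℓ) (hT : 0 < T)
    (hv : ContDiffOn ℝ 1 v (Icc 0 ℓ)) {S : Set ℝ} (hS : S ⊆ Icc 0 ℓ) (hγS : MapsTo γ S (Icc 0 T))
    {y : ℝ} (hy : y ∈ S) (hvy : v y ≠ 0) (hγ : HasDerivWithinAt γ (v y)⁻¹ S y) :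
    HasDerivWithinAt (fun y => v y * w y (γ y)) (-φ y (γ y)) S y := by
  have hy' := hS hy
  have ht := hγS hy
  have hL := ((hw.1.differentiableOn one_ne_zero) (y, γ y) ⟨hy', ht⟩).hasFDerivWithinAt
  set L := fderivWithin ℝ (fun p : ℝ × ℝ => w p.1 p.2) (Icc 0 ℓ ×ˢ Icc 0 T) (y, γ y)
  have hx : derivWithin (fun z => w z (γ y)) (Icc 0 ℓ) y = L (1, 0) := by
    have h : HasDerivWithinAt (fun z : ℝ => (z, γ y)) ((1 : ℝ), (0 : ℝ)) (Icc 0 ℓ) y :=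
      ((hasDerivAt_id y).prodMk (hasDerivAt_const y (γ y))).hasDerivWithinAt
    exact (hL.comp_hasDerivWithinAt y h fun s hs => mk_mem_prod hs ht).derivWithin
      (uniqueDiffOn_Icc hℓ y hy')
  have htime : derivWithin (fun τ => w y τ) (Icc 0 T) (γ y) = L (0, 1) := by
    have h : HasDerivWithinAt (fun s : ℝ => (y, s)) ((0 : ℝ), (1 : ℝ)) (Icc 0 T) (γ y) :=
      ((hasDerivAt_const (γ y) y).prodMk (hasDerivAt_id (γ y))).hasDerivWithinAt
    exact (hL.comp_hasDerivWithinAt (γ y) h fun s hs => mk_mem_prod hy' hs).derivWithin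
      (uniqueDiffOn_Icc hT (γ y) ht)
  have hchar : HasDerivWithinAt (fun z => w z (γ z)) (L (1, (v y)⁻¹)) S y :=
    hL.comp_hasDerivWithinAt (f := fun z => (z, γ z)) y
      ((hasDerivAt_id y).hasDerivWithinAt.prodMk hγ)
      fun s hs => mk_mem_prod (hS hs) (hγS hs)
  have hsplit : L (1, (v y)⁻¹) = L (1, 0) + (v y)⁻¹ * L (0, 1) := by
    rw [← smul_eq_mul, ← map_smul, ← map_add]
    simp
  have hpde := hw.2.1 y hy' (γ y) ht
  rw [hx, htime] at hpde
  have hv' := ((hv.differentiableOn one_ne_zero) y hy').hasDerivWithinAt.mono hS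
  refine (hv'.mul hchar).congr_deriv ?_
  rw [← hpde, hsplit]
  field_simp
  ring

/-- Two solutions with the same data agree, by integrating along characteristics. -/
theorem IsTransportSolOutflow.eq {ℓ T : ℝ} {v g : ℝ → ℝ} {φ w w' : ℝ → ℝ → ℝ}
    (hw : IsTransportSolOutflow ℓ T v φ g w) (hw' : IsTransportSolOutflow ℓ T v φ g w')
    (hℓ : 0 < ℓ) (hT : 0 < T) (hv : ContDiffOn ℝ 1 v (Icc 0 ℓ)) (hvpos : ∀ x ∈ Icc 0 ℓ, 0 < v x)
    {x t : ℝ} (hx : x ∈ Icc 0 ℓ) (ht : t ∈ Icc 0 T) : w x t = w' x t := by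
  obtain ⟨a, c, a0, -, -, cv, da, -⟩ := exists_travelTime hℓ.le hv.continuousOn hvpos
  set γ : ℝ → ℝ := fun y => a y + (t - a x) with hγ
  have γx : γ x = t := by simp [hγ]
  obtain ⟨y₀, hy₀, hy₀x, hγ₀, hstart⟩ : ∃ y₀, 0 ≤ y₀ ∧ y₀ ≤ x ∧ 0 ≤ γ y₀ ∧
      w y₀ (γ y₀) = w' y₀ (γ y₀) := by
    have hax : 0 ≤ a x := a0 ▸ a.monotone hx.1
    rcases le_total (a x) t with h | h
    · refine ⟨0, le_rfl, hx.1, by simp only [hγ, a0]; linarith, ?_⟩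
      have : γ 0 ∈ Icc 0 T := ⟨by simp only [hγ, a0]; linarith,
        by simp only [hγ, a0]; linarith [ht.2]⟩
      rw [hw.2.2.1 _ this, hw'.2.2.1 _ this]
    · have h0 : 0 ≤ a.symm (a x - t) := by
        rw [← a.le_iff_le, a0, a.apply_symm_apply]; linarith
      have h1 : a.symm (a x - t) ≤ x := by
        rw [← a.le_iff_le, a.apply_symm_apply]; linarith [ht.1]
      have h2 : γ (a.symm (a x - t)) = 0 := by simp [hγ]
      refine ⟨_, h0, h1, h2.ge, ?_⟩
      have hm : a.symm (a x - t) ∈ Icc 0 ℓ := ⟨h0, h1.trans hx.2⟩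
      rw [h2, hw.2.2.2 _ hm, hw'.2.2.2 _ hm]
  have hS : Icc y₀ x ⊆ Icc 0 ℓ := Icc_subset_Icc hy₀ hx.2
  have hγS : MapsTo γ (Icc y₀ x) (Icc 0 T) := fun y hy =>
    ⟨hγ₀.trans (by simpa [hγ] using hy.1),
      (add_le_add_left (a.monotone hy.2) _).trans (γx.le.trans ht.2)⟩
  have flux : ∀ {u}, IsTransportSolOutflow ℓ T v φ g u → ∀ y ∈ Icc y₀ x,
      HasDerivWithinAt (fun y => v y * u y (γ y)) (-φ y (γ y)) (Icc y₀ x) y := fun hu y hy =>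
    hu.hasDerivWithinAt_flux hℓ hT hv hS hγS hy (hvpos y (hS hy)).ne' <| by
      rw [← cv y (hS hy)]
      exact ((da y).add_const _).hasDerivWithinAt
  rcases eq_or_lt_of_le hy₀x with rfl | hlt
  · rwa [γx] at hstart
  have key := eq_of_derivWithin_eq (fun y hy => (flux hw y hy).differentiableWithinAt)
    (fun y hy => (flux hw' y hy).differentiableWithinAt)
    (fun y hy => by
      have hy' := Ico_subset_Icc_self hy
      have hu := uniqueDiffOn_Icc hlt y hy'
      rw [(flux hw y hy').derivWithin hu, (flux hw' y hy').derivWithin hu])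
    (by simp only [hstart]) x (right_mem_Icc.2 hy₀x)
  simp only [γx] at key
  exact mul_left_cancel₀ (hvpos x hx).ne' key

/-- Existence of a classical solution, constructed by the method of characteristics. -/
theorem exists_isTransportSolOutflow
    {ℓ T : ℝ} (hℓ : 0 < ℓ) (hT : 0 < T)
    {v : ℝ → ℝ} (hv : ContDiffOn ℝ 1 v (Icc 0 ℓ))
    (hvpos : ∀ x ∈ Icc 0 ℓ, 0 < v x)
    {φ : ℝ → ℝ → ℝ}
    (hφ : ContDiffOn ℝ 1 (fun p : ℝ × ℝ => φ p.1 p.2) (Icc 0 ℓ ×ˢ Icc 0 T))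
    (hcompatφ : φ 0 0 = 0)
    {g : ℝ → ℝ} (hg : ContDiffOn ℝ 1 g (Icc 0 T))
    (hg0 : g 0 = 0) (hg'0 : derivWithin g (Icc 0 T) 0 = 0) :
    ∃ w : ℝ → ℝ → ℝ, IsTransportSolOutflow ℓ T v φ g w := by
  have h0ℓ : (0 : ℝ) ∈ Icc 0 ℓ := ⟨le_rfl, hℓ.le⟩
  have h0T : (0 : ℝ) ∈ Icc 0 T := ⟨le_rfl, hT.le⟩
  obtain ⟨a, c, a0, cc, cpos, cv, da, dX⟩ := exists_travelTime hℓ.le hv.continuousOn hvpos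
  obtain ⟨Φ, Φ', cΦ, cΦ', dΦ, eΦ⟩ := exists_extension_snd hℓ hT hφ
  obtain ⟨G, G', cG', dG, eG⟩ : ∃ G G' : ℝ → ℝ, Continuous G' ∧ (∀ t, HasDerivAt G (G' t) t) ∧
      ∀ t ∈ Icc 0 T, G t = g t := by
    obtain ⟨G, G', -, h1, h2, h3⟩ := exists_extension_snd hℓ hT
      (f := fun p => g p.2) (hg.comp contDiff_snd.contDiffOn fun p hp => hp.2)
    exact ⟨G 0, G' 0, h1.comp (by fun_prop : Continuous fun t : ℝ => ((0 : ℝ), t)), h2 0, h3 0 h0ℓ⟩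
  have G'0 : G' 0 = 0 := by
    rw [← ((dG 0).hasDerivWithinAt.congr (fun t ht => (eG t ht).symm)
      (eG 0 h0T).symm).derivWithin (uniqueDiffOn_Icc hT 0 h0T), hg'0]
  have ca : Continuous a := a.continuous
  have cX : Continuous a.symm := a.symm.continuous
  set Ψ : ℝ → ℝ → ℝ := fun y r => Φ y (a y + r) with hΨ
  set Ψ' : ℝ → ℝ → ℝ := fun y r => Φ' y (a y + r) with hΨ'
  have cΨ : Continuous fun p : ℝ × ℝ => Ψ p.1 p.2 :=
    cΦ.comp (by fun_prop : Continuous fun p : ℝ × ℝ => (p.1, a p.1 + p.2))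
  have cΨ' : Continuous fun p : ℝ × ℝ => Ψ' p.1 p.2 :=
    cΦ'.comp (by fun_prop : Continuous fun p : ℝ × ℝ => (p.1, a p.1 + p.2))
  obtain ⟨cdI, dI⟩ := contDiff_integral_param cΨ cΨ' fun y r => (dΦ y (a y + r)).comp_const_add _ _
  set I : ℝ × ℝ → ℝ := fun p => ∫ y in (0 : ℝ)..p.1, Ψ y p.2 with hI
  have I0 : ∀ r, I (0, r) = 0 := fun r => intervalIntegral.integral_same
  -- the trace of the solution, transported along characteristics
  obtain ⟨P, P', cP', dP, Pneg, Ppos⟩ : ∃ P P' : ℝ → ℝ, Continuous P' ∧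
      (∀ r, HasDerivAt P (P' r) r) ∧ (∀ r ≤ 0, P r = I (a.symm (-r), r)) ∧
      ∀ r ≥ 0, P r = v 0 * G r := by
    have X0 : a.symm 0 = 0 := by rw [a.symm_apply_eq, a0]
    have d1 : ∀ r, HasDerivAt (fun r => I (a.symm (-r), r))
        (-c (a.symm (-r)) * Ψ (a.symm (-r)) r + ∫ y in (0 : ℝ)..a.symm (-r), Ψ' y r) r := by
      intro r
      have hX : HasDerivAt (fun r => (a.symm (-r), r)) (-c (a.symm (-r)), 1) r := by
        refine HasDerivAt.prodMk ?_ (hasDerivAt_id r)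
        simpa [Function.comp_def] using (dX (-r)).scomp r (hasDerivAt_neg r)
      simpa [Function.comp_def] using
        (dI (a.symm (-r), r)).comp_hasDerivAt (f := fun r => (a.symm (-r), r)) r hX
    have d2 : ∀ r, HasDerivAt (fun r => v 0 * G r) (v 0 * G' r) r := fun r => (dG r).const_mul _
    have e1 : I (a.symm (-0), 0) = v 0 * G 0 := by
      rw [neg_zero, X0, I0, eG 0 h0T, hg0, mul_zero]
    have e2 : (-c (a.symm (-0)) * Ψ (a.symm (-0)) 0 + ∫ y in (0 : ℝ)..a.symm (-0), Ψ' y 0)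
        = v 0 * G' 0 := by
      simp [X0, hΨ, a0, eΦ 0 h0ℓ 0 h0T, hcompatφ, G'0]
    refine ⟨_, _, ?_, hasDerivAt_ite_le d1 d2 e1 e2, fun r hr => if_pos hr, fun r hr => ?_⟩
    · refine Continuous.if_le ?_ (by fun_prop) continuous_id continuous_const ?_
      · refine Continuous.add (Continuous.mul (by fun_prop)
          (cΨ.comp (by fun_prop : Continuous fun r : ℝ => (a.symm (-r), r)))) ?_
        exact intervalIntegral.continuous_parametric_intervalIntegral_of_continuous
          (f := fun r y => Ψ' y r)
          (cΨ'.comp (by fun_prop : Continuous fun q : ℝ × ℝ => (q.2, q.1))) (by fun_prop)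
      · rintro r rfl
        exact e2
    · rcases eq_or_lt_of_le hr with rfl | hr
      · simpa using e1
      · exact if_neg hr.not_ge
  have cdP : ContDiff ℝ 1 P := contDiff_one_iff_deriv.2
    ⟨fun r => (dP r).differentiableAt, by rwa [funext fun r => (dP r).deriv]⟩
  have cda : ContDiff ℝ 1 a := contDiff_one_iff_deriv.2
    ⟨fun r => (da r).differentiableAt, by
      rw [funext fun r => (da r).deriv]; exact cc.inv₀ fun x => (cpos x).ne'⟩
  set u : ℝ → ℝ → ℝ := fun x t => P (t - a x) - I (x, t - a x) with hu
  have cdu : ContDiff ℝ 1 fun p : ℝ × ℝ => u p.1 p.2 := by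
    have h : ContDiff ℝ 1 fun p : ℝ × ℝ => p.2 - a p.1 :=
      contDiff_snd.sub (cda.comp contDiff_fst)
    exact (cdP.comp h).sub (cdI.comp (contDiff_fst.prodMk h))
  have dut : ∀ x t, HasDerivAt (u x)
      (P' (t - a x) - ∫ y in (0 : ℝ)..x, Ψ' y (t - a x)) t := by
    intro x t
    have h : HasDerivAt (fun t => t - a x) 1 t := (hasDerivAt_id t).sub_const _
    refine (((dP (t - a x)).scomp t h).sub
      ((dI (x, t - a x)).comp_hasDerivAt t ((hasDerivAt_const t x).prodMk h))).congr_deriv ?_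
    simp
  have dux : ∀ x t, HasDerivAt (fun y => u y t)
      (-(c x)⁻¹ * P' (t - a x) - (Ψ x (t - a x) - (c x)⁻¹ * ∫ y in (0 : ℝ)..x, Ψ' y (t - a x)))
      x := by
    intro x t
    have h : HasDerivAt (fun x => t - a x) (-(c x)⁻¹) x := (da x).const_sub t
    refine (((dP (t - a x)).scomp x h).sub
      ((dI (x, t - a x)).comp_hasDerivAt x ((hasDerivAt_id x).prodMk h))).congr_deriv ?_
    simp
    ring
  refine ⟨fun x t => u x t / v x, ?_, fun x hx t ht => ?_, fun t ht => ?_, fun x hx => ?_⟩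
  · exact cdu.contDiffOn.div (hv.comp contDiff_fst.contDiffOn fun p hp => hp.1)
      fun p hp => (hvpos _ hp.1).ne'
  · have hvx := (hvpos x hx).ne'
    have hv' := ((hv.differentiableOn one_ne_zero) x hx).hasDerivWithinAt
    rw [((dut x t).hasDerivWithinAt.div_const (v x)).derivWithin (uniqueDiffOn_Icc hT t ht),
      ((dux x t).hasDerivWithinAt.fun_div hv' hvx).derivWithin (uniqueDiffOn_Icc hℓ x hx), cv x hx]
    have : Ψ x (t - a x) = φ x t := by simp [hΨ, eΦ x hx t ht]
    rw [this]
    field_simp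
    ring
  · simp only [hu, a0, sub_zero, I0, Ppos t ht.1, eG t ht]
    exact mul_div_cancel_left₀ _ (hvpos 0 h0ℓ).ne'
  · have hax : 0 ≤ a x := a0 ▸ a.monotone hx.1
    simp [hu, Pneg (-a x) (by linarith)]

/-- Well-posedness (existence and uniqueness of a classical solution) of the hyperbolic
mixed problem on an edge with inflow at `x = 0` (since `v > 0`), with compatibility
conditions `φ(0,0) = 0`, `g(0) = 0` and `g'(0) = 0`. -/
theorem transport_outflow_wellposed
    (ℓ T : ℝ) (hℓ : 0 < ℓ) (hT : 0 < T)
    (v : ℝ → ℝ) (hv : ContDiffOn ℝ 1 v (Icc 0 ℓ))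
    (hvpos : ∀ x ∈ Icc 0 ℓ, 0 < v x)
    (φ : ℝ → ℝ → ℝ)
    (hφ : ContDiffOn ℝ 1 (fun p : ℝ × ℝ => φ p.1 p.2) (Icc 0 ℓ ×ˢ Icc 0 T))
    (hcompatφ : φ 0 0 = 0)
    (g : ℝ → ℝ) (hg : ContDiffOn ℝ 1 g (Icc 0 T))
    (hg0 : g 0 = 0) (hg'0 : derivWithin g (Icc 0 T) 0 = 0) :
    ∃ w : ℝ → ℝ → ℝ, IsTransportSolOutflow ℓ T v φ g w ∧
      ∀ w' : ℝ → ℝ → ℝ, IsTransportSolOutflow ℓ T v φ g w' →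
        ∀ x ∈ Icc 0 ℓ, ∀ t ∈ Icc 0 T, w' x t = w x t := by
  obtain ⟨w, hw⟩ := exists_isTransportSolOutflow hℓ hT hv hvpos hφ hcompatφ hg hg0 hg'0
  exact ⟨w, hw, fun w' hw' x hx t ht => hw'.eq hw hℓ hT hv hvpos hx ht⟩
end

section
/- Let T > 0, and for i = 1,2,3 let ℓ_i ≥ 1, h_i > 0, and v_i ∈ C¹([0,ℓ_i]) with v₁(x) < 0 on [0,ℓ₁], v₂(x) > 0 on [0,ℓ₂], v₃(x) > 0 on [0,ℓ₃], each v_i constant on some interval [0,δ_i] with δ_i > 0, and with the conservation condition h₁² v₁(0) + h₂² v₂(0) + h₃² v₃(0) = 0. For each i let φ_i ∈ C¹([0,ℓ_i]×[0,T]) vanish, uniformly in t ∈ [0,T], for x in some neighborhood of 0 and in some neighborhood of ℓ_i. Then there exists exactly one triple (w₁,w₂,w₃) with w_i ∈ C¹([0,ℓ_i]×[0,T]) such that: ∂_t w_i(x,t) + ∂_x(v_i(x) w_i(x,t)) = −φ_i(x,t) on [0,ℓ_i]×[0,T] and w_i(x,0) = 0 for all x ∈ [0,ℓ_i] (i = 1,2,3);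 w₁(ℓ₁,t) = 0 for all t ∈ [0,T]; and the continuity condition w₂(0,t) = w₁(0,t) and w₃(0,t) = w₁(0,t) holds for all t ∈ [0,T]. Moreover this solution satisfies the Kirchhoff condition Σ_{i=1}^{3} v_i(0) h_i² w_i(0,t) = 0 for all t ∈ [0,T]. -/
open Set

/-- `EdgeSol ℓ T v f w` says that `w` is a C¹ function on `[0,ℓ] × [0,T]` satisfying the
transport equation `∂ₜ w + ∂ₓ (v w) = f` (with `∂ₓ (v w) = v' w + v ∂ₓ w`) pointwise on
the closed rectangle, together with the zero initial condition `w(x,0) = 0`. -/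
def EdgeSol (ℓ T : ℝ) (v : ℝ → ℝ) (f : ℝ → ℝ → ℝ) (w : ℝ → ℝ → ℝ) : Prop :=
  ContDiffOn ℝ 1 (fun p : ℝ × ℝ => w p.1 p.2) (Icc 0 ℓ ×ˢ Icc 0 T) ∧
  (∀ x ∈ Icc 0 ℓ, ∀ t ∈ Icc 0 T,
    derivWithin (fun τ => w x τ) (Icc 0 T) t
      + (derivWithin v (Icc 0 ℓ) x * w x t + v x * derivWithin (fun y => w y t) (Icc 0 ℓ) x)
      = f x t) ∧
  (∀ x ∈ Icc 0 ℓ, w x 0 = 0)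

/-- `GraphSol` collects the conditions of the limit hyperbolic problem on the graph with
three edges: the transport equations `∂ₜ wᵢ + ∂ₓ (vᵢ wᵢ) = -φᵢ` with zero initial data,
the homogeneous Dirichlet condition at the inflow end `x = ℓ₁` of the first edge, and the
continuity condition at the common vertex `x = 0`. -/
def GraphSol (ℓ₁ ℓ₂ ℓ₃ T : ℝ) (v₁ v₂ v₃ : ℝ → ℝ) (φ₁ φ₂ φ₃ : ℝ → ℝ → ℝ)
    (w₁ w₂ w₃ : ℝ → ℝ → ℝ) : Prop :=
  EdgeSol ℓ₁ T v₁ (fun x t => - φ₁ x t) w₁ ∧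
  EdgeSol ℓ₂ T v₂ (fun x t => - φ₂ x t) w₂ ∧
  EdgeSol ℓ₃ T v₃ (fun x t => - φ₃ x t) w₃ ∧
  (∀ t ∈ Icc 0 T, w₁ ℓ₁ t = 0) ∧
  (∀ t ∈ Icc 0 T, w₂ 0 t = w₁ 0 t ∧ w₃ 0 t = w₁ 0 t)

theorem HasFDerivWithinAt.hasDerivWithinAt_fst {f : ℝ × ℝ → ℝ} {L : ℝ × ℝ →L[ℝ] ℝ}
    {s t : Set ℝ} {x y : ℝ} (hf : HasFDerivWithinAt f L (s ×ˢ t) (x, y)) (hy : y ∈ t) :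
    HasDerivWithinAt (fun z => f (z, y)) (L (1, 0)) s x := by
  have h : HasDerivWithinAt (fun z : ℝ => (z, y)) ((1 : ℝ), (0 : ℝ)) s x :=
    (hasDerivWithinAt_id x s).prodMk (hasDerivWithinAt_const x s y)
  exact HasFDerivWithinAt.comp_hasDerivWithinAt (t := s ×ˢ t) x hf h (fun z hz => ⟨hz, hy⟩)

theorem HasFDerivWithinAt.hasDerivWithinAt_snd {f : ℝ × ℝ → ℝ} {L : ℝ × ℝ →L[ℝ] ℝ}
    {s t : Set ℝ} {x y : ℝ} (hf : HasFDerivWithinAt f L (s ×ˢ t) (x, y)) (hx : x ∈ s) :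
    HasDerivWithinAt (fun z => f (x, z)) (L (0, 1)) t y := by
  have h : HasDerivWithinAt (fun z : ℝ => (x, z)) ((0 : ℝ), (1 : ℝ)) t y :=
    (hasDerivWithinAt_const y t x).prodMk (hasDerivWithinAt_id y t)
  exact HasFDerivWithinAt.comp_hasDerivWithinAt (t := s ×ˢ t) y hf h (fun z hz => ⟨hx, hz⟩)

/-- A partial derivative of a `C¹` function on a closed rectangle is jointly continuous. -/
theorem ContDiffOn.continuousOn_derivWithin_fst {f : ℝ → ℝ → ℝ} {ℓ T : ℝ}
    (hℓ : 0 < ℓ) (hT : 0 < T)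
    (hf : ContDiffOn ℝ 1 (fun p : ℝ × ℝ => f p.1 p.2) (Icc 0 ℓ ×ˢ Icc 0 T)) :
    ContinuousOn (fun p : ℝ × ℝ => derivWithin (fun y => f y p.2) (Icc 0 ℓ) p.1)
      (Icc 0 ℓ ×ˢ Icc 0 T) := by
  have hU : UniqueDiffOn ℝ (Icc (0 : ℝ) ℓ ×ˢ Icc (0 : ℝ) T) :=
    (uniqueDiffOn_Icc hℓ).prod (uniqueDiffOn_Icc hT)
  have hc := (hf.continuousOn_fderivWithin hU le_rfl).clm_apply
    (continuousOn_const (c := ((1 : ℝ), (0 : ℝ))))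
  refine hc.congr ?_
  rintro ⟨x, t⟩ ⟨hx, ht⟩
  exact ((hf.differentiableOn_one (x, t) ⟨hx, ht⟩).hasFDerivWithinAt.hasDerivWithinAt_fst
    ht).derivWithin (uniqueDiffOn_Icc hℓ x hx)

/-- The nearest point retraction of the line onto `[0, a]`. -/
noncomputable def clampIcc (a x : ℝ) : ℝ := max 0 (min a x)

theorem continuous_clampIcc (a : ℝ) : Continuous (clampIcc a) := by
  unfold clampIcc; fun_prop

theorem clampIcc_mem {a : ℝ} (ha : 0 ≤ a) (x : ℝ) : clampIcc a x ∈ Icc 0 a :=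
  ⟨le_max_left _ _, max_le ha (min_le_left _ _)⟩

theorem clampIcc_of_mem {a x : ℝ} (hx : x ∈ Icc 0 a) : clampIcc a x = x := by
  unfold clampIcc; rw [min_eq_right hx.2, max_eq_right hx.1]

/-- A continuously differentiable function on `[0, T]` vanishing to first order at `0` extends to
the whole line by zero on the negative half-line. -/
theorem exists_contDiff_extension {β : ℝ → ℝ} {T : ℝ} (hT : 0 < T)
    (hβ : ContDiffOn ℝ 1 β (Icc 0 T)) (h0 : β 0 = 0) (h0' : derivWithin β (Icc 0 T) 0 = 0) :
    ∃ b : ℝ → ℝ, ContDiff ℝ 1 b ∧ (∀ t ∈ Icc 0 T, b t = β t) ∧ ∀ t ≤ 0, b t = 0 := by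
  have hc : Continuous (fun t => derivWithin β (Icc 0 T) (clampIcc T t)) :=
    (hβ.continuousOn_derivWithin (uniqueDiffOn_Icc hT) le_rfl).comp_continuous
      (continuous_clampIcc T) (clampIcc_mem hT.le)
  have hd : ∀ t, HasDerivAt (fun t => ∫ s in (0 : ℝ)..t, derivWithin β (Icc 0 T) (clampIcc T s))
      (derivWithin β (Icc 0 T) (clampIcc T t)) t := fun t =>
    intervalIntegral.integral_hasDerivAt_right (hc.intervalIntegrable _ _)
      (hc.stronglyMeasurableAtFilter _ _) hc.continuousAt
  refine ⟨fun t => ∫ s in (0 : ℝ)..t, derivWithin β (Icc 0 T) (clampIcc T s), ?_, ?_, ?_⟩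
  · rw [contDiff_one_iff_deriv]
    refine ⟨fun t => (hd t).differentiableAt, ?_⟩
    rwa [funext fun t => (hd t).deriv]
  · have key := constant_of_derivWithin_zero (a := 0) (b := T)
      (f := fun t => (∫ s in (0 : ℝ)..t, derivWithin β (Icc 0 T) (clampIcc T s)) - β t)
      (fun t ht => ((hd t).differentiableAt.differentiableWithinAt).sub
        (hβ.differentiableOn_one t ht)) (fun t ht => by
        have ht' := Ico_subset_Icc_self ht
        have := ((hd t).hasDerivWithinAt (s := Icc 0 T)).sub
          (hβ.differentiableOn_one t ht').hasDerivWithinAt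
        rw [clampIcc_of_mem ht', sub_self] at this
        exact this.derivWithin (uniqueDiffOn_Icc hT t ht'))
    intro t ht
    have := key t ht
    simp only [intervalIntegral.integral_same, h0] at this
    linarith
  · intro t ht
    have : EqOn (fun s => derivWithin β (Icc 0 T) (clampIcc T s)) (fun _ => 0) (uIcc 0 t) := by
      intro s hs
      rw [uIcc_of_ge ht] at hs
      have : clampIcc T s = 0 := by
        unfold clampIcc
        exact max_eq_left ((min_le_right _ _).trans hs.2)
      simp only [this, h0']
    simp only [intervalIntegral.integral_congr this]
    simp

/-- Integrals of `g` along the characteristics of the unit speed transport equation. -/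
theorem contDiff_integral_characteristic {g g' : ℝ → ℝ → ℝ}
    (hg : Continuous (fun p : ℝ × ℝ => g p.1 p.2))
    (hg' : Continuous (fun p : ℝ × ℝ => g' p.1 p.2))
    (hgd : ∀ s t, HasDerivAt (fun s => g s t) (g' s t) s) :
    ContDiff ℝ 1 (fun p : ℝ × ℝ => ∫ s in (0 : ℝ)..p.2, g (p.1 + s) s) := by
  have hc : ∀ a, Continuous fun s => g (a + s) s := fun a =>
    hg.comp (f := fun s => (a + s, s)) (by fun_prop)
  have hc' : ∀ a, Continuous fun s => g' (a + s) s := fun a =>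
    hg'.comp (f := fun s => (a + s, s)) (by fun_prop)
  have h1 : ∀ a t, HasDerivAt (fun a => ∫ s in (0 : ℝ)..t, g (a + s) s)
      (∫ s in (0 : ℝ)..t, g' (a + s) s) a := by
    intro a t
    have hK : IsCompact (Metric.closedBall a 1 ×ˢ uIcc 0 t) :=
      (isCompact_closedBall a 1).prod isCompact_uIcc
    have hcc : Continuous fun p : ℝ × ℝ => g' (p.1 + p.2) p.2 :=
      hg'.comp (f := fun p : ℝ × ℝ => (p.1 + p.2, p.2)) (by fun_prop)
    obtain ⟨C, hC⟩ := hK.exists_bound_of_continuousOn hcc.continuousOn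
    refine (intervalIntegral.hasDerivAt_integral_of_dominated_loc_of_deriv_le
      (F' := fun a s => g' (a + s) s) (bound := fun _ => C)
      (Metric.closedBall_mem_nhds a one_pos) (Filter.Eventually.of_forall fun a =>
        (hc a).aestronglyMeasurable) ((hc a).intervalIntegrable _ _)
      (hc' a).aestronglyMeasurable ?_ (intervalIntegrable_const) ?_).2
    · exact Filter.Eventually.of_forall fun s hs x hx => hC (x, s) ⟨hx, uIoc_subset_uIcc hs⟩
    · exact Filter.Eventually.of_forall fun s hs x hx => (hgd (x + s) s).comp_add_const x s
  have h2 : ∀ a t, HasDerivAt (fun t => ∫ s in (0 : ℝ)..t, g (a + s) s) (g (a + t) t) t :=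
    fun a t => intervalIntegral.integral_hasDerivAt_right ((hc a).intervalIntegrable _ _)
      ((hc a).stronglyMeasurableAtFilter _ _) (hc a).continuousAt
  have hc1 : Continuous fun p : ℝ × ℝ => ∫ s in (0 : ℝ)..p.2, g' (p.1 + s) s :=
    intervalIntegral.continuous_parametric_intervalIntegral_of_continuous
      (f := fun (p : ℝ × ℝ) s => g' (p.1 + s) s)
      (hg'.comp (f := fun q : (ℝ × ℝ) × ℝ => (q.1.1 + q.2, q.2)) (by fun_prop)) continuous_snd
  have hc2 : Continuous fun p : ℝ × ℝ => g (p.1 + p.2) p.2 :=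
    hg.comp (f := fun p : ℝ × ℝ => (p.1 + p.2, p.2)) (by fun_prop)
  let A : ℝ → ℝ → ℝ →L[ℝ] ℝ := fun a t =>
    ContinuousLinearMap.toSpanSingleton ℝ (∫ s in (0 : ℝ)..t, g' (a + s) s)
  let B : ℝ → ℝ → ℝ →L[ℝ] ℝ := fun a t => ContinuousLinearMap.toSpanSingleton ℝ (g (a + t) t)
  have hA : Continuous (fun p : ℝ × ℝ => A p.1 p.2) :=
    (ContinuousLinearMap.toSpanSingletonCLE (𝕜 := ℝ) (E := ℝ)).continuous.comp hc1
  have hB : Continuous (fun p : ℝ × ℝ => B p.1 p.2) :=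
    (ContinuousLinearMap.toSpanSingletonCLE (𝕜 := ℝ) (E := ℝ)).continuous.comp hc2
  rw [contDiff_one_iff_hasFDerivAt]
  refine ⟨fun p => (A p.1 p.2).coprod (B p.1 p.2), ?_, fun p => ?_⟩
  · exact (ContinuousLinearMap.coprodEquivL ℝ (𝕜 := ℝ) (E := ℝ) (F := ℝ) (G := ℝ)).continuous.comp
      (hA.prodMk hB)
  · exact (hasStrictFDerivAt_uncurry_coprod (f := fun a t => ∫ s in (0 : ℝ)..t, g (a + s) s)
      (f₁ := A) (f₂ := B)
      (Filter.Eventually.of_forall fun q => (h1 q.1 q.2).hasFDerivAt)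
      (Filter.Eventually.of_forall fun q => (h2 q.1 q.2).hasFDerivAt)
      hA.continuousAt hB.continuousAt).hasFDerivAt

/-- Solvability of the unit speed transport equation `∂ₜ Z + ∂ₛ Z = g`. -/
theorem exists_unit_transport {g g' : ℝ → ℝ → ℝ} {b : ℝ → ℝ}
    (hg : Continuous (fun p : ℝ × ℝ => g p.1 p.2))
    (hg' : Continuous (fun p : ℝ × ℝ => g' p.1 p.2))
    (hgd : ∀ s t, HasDerivAt (fun s => g s t) (g' s t) s)
    (hg0 : ∀ s ≤ 0, ∀ t, g s t = 0) (hb : ContDiff ℝ 1 b) (hb0 : ∀ t ≤ 0, b t = 0) :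
    ∃ Z : ℝ × ℝ → ℝ, ContDiff ℝ 1 Z ∧ (∀ p, fderiv ℝ Z p (1, 1) = g p.1 p.2) ∧
      (∀ s, 0 ≤ s → Z (s, 0) = 0) ∧ ∀ t, 0 ≤ t → Z (0, t) = b t := by
  have hJ := contDiff_integral_characteristic hg hg' hgd
  have hZ : ContDiff ℝ 1 (fun p : ℝ × ℝ =>
      b (p.2 - p.1) + ∫ s in (0 : ℝ)..p.2, g (p.1 - p.2 + s) s) :=
    (hb.comp (contDiff_snd.sub contDiff_fst)).add
      (hJ.comp ((contDiff_fst.sub contDiff_snd).prodMk contDiff_snd))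
  refine ⟨_, hZ, ?_, ?_, ?_⟩
  · rintro ⟨s, t⟩
    have hγ : HasDerivAt (fun h : ℝ => (s + h, t + h)) ((1 : ℝ), (1 : ℝ)) 0 :=
      ((hasDerivAt_id (0 : ℝ)).const_add s).prodMk ((hasDerivAt_id (0 : ℝ)).const_add t)
    have hd := (hZ.differentiable_one ((fun h : ℝ => (s + h, t + h)) 0)).hasFDerivAt
    have h1 := hd.comp_hasDerivAt (0 : ℝ) hγ
    have hc : Continuous fun r => g (s - t + r) r :=
      hg.comp (f := fun r => (s - t + r, r)) (by fun_prop)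
    have h2 : HasDerivAt (fun h => b (t - s) + ∫ r in (0 : ℝ)..(t + h), g (s - t + r) r)
        (g (s - t + (t + 0)) (t + 0)) 0 :=
      (HasDerivAt.comp_const_add t 0 (intervalIntegral.integral_hasDerivAt_right
        (hc.intervalIntegrable _ _) (hc.stronglyMeasurableAtFilter _ _)
        hc.continuousAt)).const_add _
    have h3 := h1.unique (h2.congr_of_eventuallyEq (Filter.Eventually.of_forall fun h => by
      simp only [Function.comp_apply, add_sub_add_right_eq_sub]))
    simpa using h3
  · intro s hs
    simp [hb0 (-s) (by linarith)]
  · intro t ht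
    have : EqOn (fun r => g (0 - t + r) r) (fun _ => 0) (uIcc 0 t) := by
      intro r hr
      rw [uIcc_of_le ht] at hr
      exact hg0 _ (by linarith [hr.2]) _
    simp only [intervalIntegral.integral_congr this]
    simp

/-- Travel time coordinates for a positive continuous velocity field on `[0, ℓ]`. -/
theorem exists_travel_time_s2 {v : ℝ → ℝ} {ℓ : ℝ} (hℓ : 0 < ℓ) (hv : ContinuousOn v (Icc 0 ℓ))
    (hpos : ∀ x ∈ Icc 0 ℓ, 0 < v x) :
    ∃ y X : ℝ → ℝ, (∀ x, HasDerivAt y (v (clampIcc ℓ x))⁻¹ x) ∧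
      (∀ s, HasDerivAt X (v (clampIcc ℓ (X s))) s) ∧ (∀ x, X (y x) = x) ∧ (∀ s, y (X s) = s) ∧
      y 0 = 0 ∧ StrictMono y := by
  have hvc : Continuous fun x => v (clampIcc ℓ x) :=
    hv.comp_continuous (continuous_clampIcc ℓ) (clampIcc_mem hℓ.le)
  have hvp : ∀ x, 0 < v (clampIcc ℓ x) := fun x => hpos _ (clampIcc_mem hℓ.le x)
  have hic : Continuous fun x => (v (clampIcc ℓ x))⁻¹ := hvc.inv₀ fun x => (hvp x).ne'
  obtain ⟨C, hC⟩ := isCompact_Icc.exists_bound_of_continuousOn hv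
  have hCv : ∀ x, v (clampIcc ℓ x) ≤ C := fun x =>
    (le_abs_self _).trans (hC _ (clampIcc_mem hℓ.le x))
  have hC0 : 0 < C := (hvp 0).trans_le (hCv 0)
  set y : ℝ → ℝ := fun x => ∫ s in (0 : ℝ)..x, (v (clampIcc ℓ s))⁻¹ with hy
  have hd : ∀ x, HasDerivAt y (v (clampIcc ℓ x))⁻¹ x := fun x =>
    intervalIntegral.integral_hasDerivAt_right (hic.intervalIntegrable _ _)
      (hic.stronglyMeasurableAtFilter _ _) hic.continuousAt
  have hy0 : y 0 = 0 := by simp [hy]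
  have hmono : StrictMono y := strictMono_of_deriv_pos fun x => by
    rw [(hd x).deriv]; exact inv_pos.2 (hvp x)
  have hcont : Continuous y := continuous_iff_continuousAt.2 fun x => (hd x).continuousAt
  have hm : Monotone fun x => y x - C⁻¹ * x := by
    have hd' : ∀ x, HasDerivAt (fun x => y x - C⁻¹ * x) ((v (clampIcc ℓ x))⁻¹ - C⁻¹) x :=
      fun x => by
        simpa only [mul_one] using! (hd x).sub ((hasDerivAt_id x).const_mul C⁻¹)
    refine monotone_of_deriv_nonneg (fun x => (hd' x).differentiableAt) fun x => ?_
    rw [(hd' x).deriv]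
    exact sub_nonneg.2 (inv_anti₀ (hvp x) (hCv x))
  have htop : Filter.Tendsto y Filter.atTop Filter.atTop := by
    refine Filter.tendsto_atTop_mono' _ ?_
      (Filter.tendsto_id.const_mul_atTop (inv_pos.2 hC0))
    filter_upwards [Filter.eventually_ge_atTop 0] with x hx
    have := hm hx
    simp only [hy0, mul_zero, sub_zero] at this
    simp only [id]; linarith
  have hbot : Filter.Tendsto y Filter.atBot Filter.atBot := by
    refine Filter.tendsto_atBot_mono' _ ?_
      (Filter.tendsto_id.const_mul_atBot (inv_pos.2 hC0))
    filter_upwards [Filter.eventually_le_atBot 0] with x hx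
    have := hm hx
    simp only [hy0, mul_zero, sub_zero] at this
    simp only [id]; linarith
  let e := hmono.orderIsoOfSurjective y (hcont.surjective htop hbot)
  have he : ∀ s, y (e.symm s) = s := fun s => e.apply_symm_apply s
  refine ⟨y, e.symm, hd, fun s => ?_, fun x => e.symm_apply_apply x, he, hy0, hmono⟩
  have := HasDerivAt.of_local_left_inverse (f := y) (g := e.symm) (a := s)
    e.symm.continuous.continuousAt (hd (e.symm s)) (inv_pos.2 (hvp _)).ne'
    (Filter.Eventually.of_forall he)
  simpa using this

/-- Extension by zero of a function vanishing near both endpoints preserves differentiability. -/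
theorem hasDerivAt_clamp_of_vanishing {f : ℝ → ℝ} {ℓ δ : ℝ} (hℓ : 0 < ℓ) (hδ : 0 < δ)
    (hf : DifferentiableOn ℝ f (Icc 0 ℓ)) (h0 : ∀ x ∈ Icc 0 δ, f x = 0)
    (h1 : ∀ x ∈ Icc (ℓ - δ) ℓ, f x = 0) (x : ℝ) :
    HasDerivAt (fun x => f (clampIcc ℓ x)) (derivWithin f (Icc 0 ℓ) (clampIcc ℓ x)) x := by
  rcases le_or_gt x 0 with hx | hx
  · have hcl : clampIcc ℓ x = 0 := max_eq_left ((min_le_right _ _).trans hx)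
    have hd : derivWithin f (Icc 0 ℓ) 0 = 0 := by
      have : HasDerivWithinAt f 0 (Icc 0 ℓ) 0 :=
        (hasDerivWithinAt_const (0 : ℝ) (Icc 0 ℓ) (0 : ℝ)).congr_of_eventuallyEq
          (by
            filter_upwards [self_mem_nhdsWithin, mem_nhdsWithin_of_mem_nhds (Iio_mem_nhds hδ)]
              with z hz hz'
            exact h0 z ⟨hz.1, le_of_lt hz'⟩) (h0 0 ⟨le_rfl, hδ.le⟩)
      exact this.derivWithin (uniqueDiffOn_Icc hℓ 0 ⟨le_rfl, hℓ.le⟩)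
    rw [hcl, hd]
    refine (hasDerivAt_const x (0 : ℝ)).congr_of_eventuallyEq ?_
    filter_upwards [Iio_mem_nhds (hx.trans_lt hδ)] with z hz
    exact h0 _ ⟨le_max_left _ _, max_le hδ.le ((min_le_right _ _).trans (le_of_lt hz))⟩
  rcases le_or_gt ℓ x with hx' | hx'
  · have hcl : clampIcc ℓ x = ℓ := by
      unfold clampIcc; rw [min_eq_left hx', max_eq_right hℓ.le]
    have hd : derivWithin f (Icc 0 ℓ) ℓ = 0 := by
      have : HasDerivWithinAt f 0 (Icc 0 ℓ) ℓ :=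
        (hasDerivWithinAt_const ℓ (Icc 0 ℓ) (0 : ℝ)).congr_of_eventuallyEq
          (by
            filter_upwards [self_mem_nhdsWithin,
              mem_nhdsWithin_of_mem_nhds (Ioi_mem_nhds (show ℓ - δ < ℓ by linarith))] with z hz hz'
            exact h1 z ⟨le_of_lt hz', hz.2⟩) (h1 ℓ ⟨by linarith, le_rfl⟩)
      exact this.derivWithin (uniqueDiffOn_Icc hℓ ℓ ⟨hℓ.le, le_rfl⟩)
    rw [hcl, hd]
    refine (hasDerivAt_const x (0 : ℝ)).congr_of_eventuallyEq ?_
    filter_upwards [Ioi_mem_nhds (show ℓ - δ < x by linarith)] with z hz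
    exact h1 _ ⟨le_max_of_le_right (le_min (by linarith) (le_of_lt hz)),
      (clampIcc_mem hℓ.le z).2⟩
  · rw [clampIcc_of_mem ⟨hx.le, hx'.le⟩]
    refine ((hf x ⟨hx.le, hx'.le⟩).hasDerivWithinAt.hasDerivAt
      (Icc_mem_nhds hx hx')).congr_of_eventuallyEq ?_
    filter_upwards [Icc_mem_nhds hx hx'] with z hz
    rw [clampIcc_of_mem hz]

/-- The transport equation with positive velocity, zero initial datum and prescribed inflow datum
`β` at `x = 0` has a classical solution. -/
theorem exists_edgeSol {ℓ T : ℝ} (hℓ : 0 < ℓ) (hT : 0 < T) {v : ℝ → ℝ} {φ : ℝ → ℝ → ℝ}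
    {β : ℝ → ℝ} (hv : ContDiffOn ℝ 1 v (Icc 0 ℓ)) (hpos : ∀ x ∈ Icc 0 ℓ, 0 < v x)
    (hφ : ContDiffOn ℝ 1 (fun p : ℝ × ℝ => φ p.1 p.2) (Icc 0 ℓ ×ˢ Icc 0 T))
    (hφ0 : ∃ δ > 0, ∀ t ∈ Icc 0 T,
      (∀ x ∈ Icc 0 δ, φ x t = 0) ∧ (∀ x ∈ Icc (ℓ - δ) ℓ, φ x t = 0))
    (hβ : ContDiffOn ℝ 1 β (Icc 0 T)) (hβ0 : β 0 = 0) (hβ0' : derivWithin β (Icc 0 T) 0 = 0) :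
    ∃ w : ℝ → ℝ → ℝ, EdgeSol ℓ T v (fun x t => - φ x t) w ∧ ∀ t ∈ Icc 0 T, w 0 t = β t := by
  have h0ℓ : (0 : ℝ) ∈ Icc 0 ℓ := ⟨le_rfl, hℓ.le⟩
  obtain ⟨δ, hδ, hφδ⟩ := hφ0
  obtain ⟨y, X, hy, hX, hXy, hyX, hy0, hymono⟩ := exists_travel_time_s2 hℓ hv.continuousOn hpos
  obtain ⟨b, hb, hbβ, hb0⟩ := exists_contDiff_extension (β := fun t => v 0 * β t) hT
    (contDiffOn_const.mul hβ) (by simp [hβ0]) (by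
      have := ((hβ.differentiableOn_one 0 ⟨le_rfl, hT.le⟩).hasDerivWithinAt.const_mul
        (v 0)).derivWithin (uniqueDiffOn_Icc hT 0 ⟨le_rfl, hT.le⟩)
      rw [this, hβ0', mul_zero])
  let f : ℝ → ℝ → ℝ := fun x t => -(v x * φ x t)
  have hf : ContDiffOn ℝ 1 (fun p : ℝ × ℝ => f p.1 p.2) (Icc 0 ℓ ×ˢ Icc 0 T) :=
    ((hv.comp contDiff_fst.contDiffOn fun p hp => hp.1).mul hφ).neg
  have hf0 : ∀ t ∈ Icc 0 T, ∀ x ∈ Icc 0 δ, f x t = 0 := fun t ht x hx => by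
    simp [f, (hφδ t ht).1 x hx]
  have hf1 : ∀ t ∈ Icc 0 T, ∀ x ∈ Icc (ℓ - δ) ℓ, f x t = 0 := fun t ht x hx => by
    simp [f, (hφδ t ht).2 x hx]
  have hXc : Continuous X := continuous_iff_continuousAt.2 fun s => (hX s).continuousAt
  have hcl : Continuous fun p : ℝ × ℝ => (clampIcc ℓ (X p.1), clampIcc T p.2) :=
    ((continuous_clampIcc ℓ).comp (hXc.comp continuous_fst)).prodMk
      ((continuous_clampIcc T).comp continuous_snd)
  have hclm : ∀ p : ℝ × ℝ, (clampIcc ℓ (X p.1), clampIcc T p.2) ∈ Icc 0 ℓ ×ˢ Icc 0 T :=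
    fun p => ⟨clampIcc_mem hℓ.le _, clampIcc_mem hT.le _⟩
  have hvc : Continuous fun p : ℝ × ℝ => v (clampIcc ℓ (X p.1)) :=
    hv.continuousOn.comp_continuous ((continuous_clampIcc ℓ).comp (hXc.comp continuous_fst))
      fun p => clampIcc_mem hℓ.le _
  obtain ⟨Z, hZ, hZeq, hZ0, hZb⟩ := exists_unit_transport
    (g := fun s t => f (clampIcc ℓ (X s)) (clampIcc T t))
    (g' := fun s t => derivWithin (fun x => f x (clampIcc T t)) (Icc 0 ℓ) (clampIcc ℓ (X s))
      * v (clampIcc ℓ (X s))) (b := b)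
    (hf.continuousOn.comp_continuous hcl hclm)
    (((hf.continuousOn_derivWithin_fst hℓ hT).comp_continuous hcl hclm).mul hvc)
    (fun s t => by
      have ht := clampIcc_mem hT.le t
      refine HasDerivAt.comp (h₂ := fun x => f (clampIcc ℓ x) (clampIcc T t)) s
        (hasDerivAt_clamp_of_vanishing hℓ hδ (fun x hx => ?_)
        (hf0 _ ht) (hf1 _ ht) (X s)) (hX s)
      exact ((hf.differentiableOn_one (x, clampIcc T t)
        ⟨hx, ht⟩).hasFDerivWithinAt.hasDerivWithinAt_fst ht).differentiableWithinAt)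
    (fun s hs t => by
      have hXs : X s ≤ 0 := hymono.le_iff_le.1 (by rw [hyX, hy0]; exact hs)
      have : clampIcc ℓ (X s) = 0 := max_eq_left ((min_le_right _ _).trans hXs)
      simp only [this]
      exact hf0 _ (clampIcc_mem hT.le t) 0 ⟨le_rfl, hδ.le⟩)
    hb hb0
  have hyC : ContDiff ℝ 1 y := by
    rw [contDiff_one_iff_deriv]
    refine ⟨fun x => (hy x).differentiableAt, ?_⟩
    rw [funext fun x => (hy x).deriv]
    exact (hv.continuousOn.comp_continuous (continuous_clampIcc ℓ)
      (clampIcc_mem hℓ.le)).inv₀ fun x => (hpos _ (clampIcc_mem hℓ.le x)).ne'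
  have hw : ContDiffOn ℝ 1 (fun p : ℝ × ℝ => Z (y p.1, p.2) / v p.1) (Icc 0 ℓ ×ˢ Icc 0 T) :=
    (hZ.comp ((hyC.comp contDiff_fst).prodMk contDiff_snd)).contDiffOn.div
      (hv.comp contDiff_fst.contDiffOn fun p hp => hp.1) fun p hp => (hpos _ hp.1).ne'
  refine ⟨fun x t => Z (y x, t) / v x, ⟨hw, ?_, ?_⟩, ?_⟩
  · intro x hx t ht
    have hvx := (hpos x hx).ne'
    have hL := (hZ.differentiable_one (y x, t)).hasFDerivAt
    set L := fderiv ℝ Z (y x, t) with hLdef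
    have hsum : L (1, 0) + L (0, 1) = -(v x * φ x t) := by
      have := hZeq (y x, t)
      simp only [hXy, clampIcc_of_mem hx, clampIcc_of_mem ht] at this
      rw [← map_add, show -(v x * φ x t) = f x t from rfl, ← this]; simp [hLdef]
    have h1 : HasDerivWithinAt (fun τ => Z (y x, τ) / v x) (L (0, 1) / v x) (Icc 0 T) t :=
      ((hL.comp_hasDerivAt t ((hasDerivAt_const t (y x)).prodMk
        (hasDerivAt_id t))).div_const (v x)).hasDerivWithinAt
    have h2 : HasDerivWithinAt (fun z => Z (y z, t)) (L (1, 0) / v x) (Icc 0 ℓ) x := by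
      have := (hL.comp_hasDerivAt x ((hy x).prodMk (hasDerivAt_const x t))).hasDerivWithinAt
        (s := Icc 0 ℓ)
      rw [clampIcc_of_mem hx] at this
      convert! this using 1
      rw [show ((v x)⁻¹, (0 : ℝ)) = (v x)⁻¹ • ((1 : ℝ), (0 : ℝ)) by simp, map_smul, smul_eq_mul]
      ring
    have h3 := (hv.differentiableOn_one x hx).hasDerivWithinAt.mul
      ((hw.differentiableOn_one (x, t) ⟨hx, ht⟩).hasFDerivWithinAt.hasDerivWithinAt_fst
        ht).differentiableWithinAt.hasDerivWithinAt
    have hcongr : ∀ z ∈ Icc 0 ℓ, (v * fun z => Z (y z, t) / v z) z = Z (y z, t) := fun z hz => by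
      simp only [Pi.mul_apply]
      rw [mul_div_cancel₀ _ (hpos z hz).ne']
    have h4 := (h2.congr hcongr (hcongr x hx)).derivWithin (uniqueDiffOn_Icc hℓ x hx)
    rw [h3.derivWithin (uniqueDiffOn_Icc hℓ x hx)] at h4
    simp only at h4
    rw [h1.derivWithin (uniqueDiffOn_Icc hT t ht), h4, ← add_div, add_comm (L (0, 1)), hsum]
    field_simp
  · intro x hx
    simp [hZ0 (y x) (by rw [← hy0]; exact hymono.monotone hx.1)]
  · intro t ht
    simp only [hy0, hZb t ht.1, hbβ t ht]
    rw [mul_div_cancel_left₀ _ (hpos 0 h0ℓ).ne']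

/-- Classical solutions of the transport equation with positive velocity are determined by their
inflow datum. -/
theorem EdgeSol.eq_of_eq_inflow {ℓ T : ℝ} (hℓ : 0 < ℓ) (hT : 0 < T) {v : ℝ → ℝ}
    {f w w' : ℝ → ℝ → ℝ} (hv : ContDiffOn ℝ 1 v (Icc 0 ℓ)) (hpos : ∀ x ∈ Icc 0 ℓ, 0 < v x)
    (hw : EdgeSol ℓ T v f w) (hw' : EdgeSol ℓ T v f w')
    (h0 : ∀ t ∈ Icc 0 T, w 0 t = w' 0 t) :
    ∀ x ∈ Icc 0 ℓ, ∀ t ∈ Icc 0 T, w x t = w' x t := by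
  intro x₀ hx₀ t₀ ht₀
  obtain ⟨y, X, hy, hX, hXy, hyX, hy0, hymono⟩ := exists_travel_time_s2 hℓ hv.continuousOn hpos
  let z : ℝ × ℝ → ℝ := fun p => v p.1 * (w p.1 p.2 - w' p.1 p.2)
  have hz : ContDiffOn ℝ 1 z (Icc 0 ℓ ×ˢ Icc 0 T) :=
    (hv.comp contDiff_fst.contDiffOn fun p hp => hp.1).mul (hw.1.sub hw'.1)
  have hzd : ∀ x ∈ Icc 0 ℓ, ∀ t ∈ Icc 0 T,
      fderivWithin ℝ z (Icc 0 ℓ ×ˢ Icc 0 T) (x, t) (v x, 1) = 0 := by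
    intro x hx t ht
    have hL := (hz.differentiableOn_one (x, t) ⟨hx, ht⟩).hasFDerivWithinAt
    set L := fderivWithin ℝ z (Icc 0 ℓ ×ˢ Icc 0 T) (x, t)
    have hux := uniqueDiffOn_Icc hℓ x hx
    have hut := uniqueDiffOn_Icc hT t ht
    have hd := (hw.1.differentiableOn_one (x, t) ⟨hx, ht⟩).hasFDerivWithinAt
    have hd' := (hw'.1.differentiableOn_one (x, t) ⟨hx, ht⟩).hasFDerivWithinAt
    have ex := (hL.hasDerivWithinAt_fst ht).derivWithin hux
    have ex' := ((hv.differentiableOn_one x hx).hasDerivWithinAt.mul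
      ((hd.hasDerivWithinAt_fst ht).differentiableWithinAt.hasDerivWithinAt.sub
        (hd'.hasDerivWithinAt_fst ht).differentiableWithinAt.hasDerivWithinAt)).derivWithin hux
    have et := (hL.hasDerivWithinAt_snd hx).derivWithin hut
    have et' := (((hd.hasDerivWithinAt_snd hx).differentiableWithinAt.hasDerivWithinAt.sub
      (hd'.hasDerivWithinAt_snd hx).differentiableWithinAt.hasDerivWithinAt).const_mul
        (v x)).derivWithin hut
    have hex := ex.symm.trans ex'
    have het := et.symm.trans et'
    have e1 := hw.2.1 x hx t ht
    have e2 := hw'.2.1 x hx t ht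
    simp only [Pi.sub_apply] at hex het
    rw [show (v x, (1 : ℝ)) = v x • ((1 : ℝ), (0 : ℝ)) + ((0 : ℝ), (1 : ℝ)) by simp, map_add,
      map_smul, smul_eq_mul, hex, het]
    linear_combination v x * (e1 - e2)
  set s₀ := y x₀
  have hs₀ : 0 ≤ s₀ := by rw [← hy0]; exact hymono.monotone hx₀.1
  set a := max 0 (t₀ - s₀) with ha
  have hat : a ≤ t₀ := max_le ht₀.1 (by linarith)
  have hmem : ∀ τ ∈ Icc a t₀, X (s₀ - t₀ + τ) ∈ Icc 0 ℓ ∧ τ ∈ Icc 0 T := by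
    intro τ hτ
    have h1 : 0 ≤ τ := (le_max_left _ _).trans hτ.1
    have h2 : t₀ - s₀ ≤ τ := (le_max_right _ _).trans hτ.1
    refine ⟨⟨?_, ?_⟩, h1, hτ.2.trans ht₀.2⟩
    · rw [← hymono.le_iff_le, hyX, hy0]; linarith
    · refine le_trans ?_ hx₀.2
      rw [← hymono.le_iff_le, hyX]; linarith [hτ.2]
  have hder : ∀ τ ∈ Icc a t₀,
      HasDerivWithinAt (fun τ => z (X (s₀ - t₀ + τ), τ)) 0 (Icc a t₀) τ := by
    intro τ hτ
    obtain ⟨h1, h2⟩ := hmem τ hτ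
    have hγ : HasDerivWithinAt (fun τ => (X (s₀ - t₀ + τ), τ))
        (v (X (s₀ - t₀ + τ)), (1 : ℝ)) (Icc a t₀) τ := by
      have := (hX (s₀ - t₀ + τ)).comp_const_add (s₀ - t₀) τ
      rw [clampIcc_of_mem h1] at this
      exact (this.prodMk (hasDerivAt_id τ)).hasDerivWithinAt
    have := HasFDerivWithinAt.comp_hasDerivWithinAt (t := Icc 0 ℓ ×ˢ Icc 0 T) τ
      (hz.differentiableOn_one _ ⟨h1, h2⟩).hasFDerivWithinAt hγ hmem
    rwa [hzd _ h1 _ h2] at this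
  have hconst := constant_of_has_deriv_right_zero (a := a) (b := t₀)
    (f := fun τ => z (X (s₀ - t₀ + τ), τ))
    (fun τ hτ => (hder τ hτ).continuousWithinAt)
    (fun τ hτ => (hder τ (Ico_subset_Icc_self hτ)).mono_of_mem_nhdsWithin
      (Icc_mem_nhdsGE_of_mem hτ)) t₀ ⟨hat, le_rfl⟩
  have hend : z (X (s₀ - t₀ + a), a) = 0 := by
    obtain ⟨h1, h2⟩ := hmem a ⟨le_rfl, hat⟩
    rcases le_total (t₀ - s₀) 0 with h | h
    · have ha0 : a = 0 := max_eq_left h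
      rw [ha0] at h1 ⊢
      simp only [z, hw.2.2 _ h1, hw'.2.2 _ h1, sub_self, mul_zero]
    · have ha0 : a = t₀ - s₀ := max_eq_right h
      have hXa : X (s₀ - t₀ + a) = 0 := by
        rw [ha0, show s₀ - t₀ + (t₀ - s₀) = y 0 by rw [hy0]; ring, hXy]
      simp only [z, hXa, h0 a h2, sub_self, mul_zero]
  simp only [hend] at hconst
  rw [sub_add_cancel, hXy] at hconst
  exact sub_eq_zero.1 ((mul_eq_zero.1 hconst).resolve_left (hpos x₀ hx₀).ne')

theorem derivWithin_Icc_reflect (f : ℝ → ℝ) (ℓ x : ℝ) :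
    derivWithin (fun y => f (ℓ - y)) (Icc 0 ℓ) x = -derivWithin f (Icc 0 ℓ) (ℓ - x) := by
  rw [derivWithin_comp_const_sub]
  congr 2
  simp

/-- Reversal of the orientation of an edge. -/
theorem EdgeSol.reflect {ℓ T : ℝ} {v : ℝ → ℝ} {f w : ℝ → ℝ → ℝ} (h : EdgeSol ℓ T v f w) :
    EdgeSol ℓ T (fun x => -v (ℓ - x)) (fun x t => f (ℓ - x) t) (fun x t => w (ℓ - x) t) := by
  have hr : ∀ x ∈ Icc 0 ℓ, ℓ - x ∈ Icc 0 ℓ := fun x hx => ⟨by linarith [hx.2], by linarith [hx.1]⟩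
  refine ⟨?_, fun x hx t ht => ?_, fun x hx => h.2.2 _ (hr x hx)⟩
  · exact h.1.comp (f := fun p : ℝ × ℝ => (ℓ - p.1, p.2))
      ((contDiff_const.sub contDiff_fst).prodMk contDiff_snd).contDiffOn
      fun p hp => ⟨hr _ hp.1, hp.2⟩
  · have := h.2.1 (ℓ - x) (hr x hx) t ht
    rw [derivWithin_Icc_reflect (fun y => w y t), derivWithin_Icc_reflect (fun y => -v y),
      derivWithin.fun_neg]
    linarith

/-- The value at an endpoint of a solution without source there vanishes to first order. -/
theorem EdgeSol.derivWithin_vertex {ℓ T : ℝ} (hℓ : 0 < ℓ) (hT : 0 < T) {v : ℝ → ℝ}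
    {f w : ℝ → ℝ → ℝ} (h : EdgeSol ℓ T v f w) (hf : f 0 0 = 0) :
    derivWithin (fun τ => w 0 τ) (Icc 0 T) 0 = 0 := by
  have h0 : (0 : ℝ) ∈ Icc 0 ℓ := ⟨le_rfl, hℓ.le⟩
  have := h.2.1 0 h0 0 ⟨le_rfl, hT.le⟩
  have hx : derivWithin (fun y => w y 0) (Icc 0 ℓ) 0 = 0 := by
    rw [derivWithin_congr (f := fun _ => (0 : ℝ)) h.2.2 (h.2.2 0 h0)]
    simp
  rw [h.2.2 0 h0, hx, hf] at this
  linarith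

/-- Unique classical solvability of the limit hyperbolic problem on the graph
(problem (3.15) of the paper), together with the Kirchhoff condition at the vertex. -/
theorem graph_transport_wellposed
    (T : ℝ) (hT : 0 < T)
    (ℓ₁ ℓ₂ ℓ₃ : ℝ) (hℓ₁ : 1 ≤ ℓ₁) (hℓ₂ : 1 ≤ ℓ₂) (hℓ₃ : 1 ≤ ℓ₃)
    (h₁ h₂ h₃ : ℝ) (hh₁ : 0 < h₁) (hh₂ : 0 < h₂) (hh₃ : 0 < h₃)
    (v₁ v₂ v₃ : ℝ → ℝ)
    (hv₁ : ContDiffOn ℝ 1 v₁ (Icc 0 ℓ₁))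
    (hv₂ : ContDiffOn ℝ 1 v₂ (Icc 0 ℓ₂))
    (hv₃ : ContDiffOn ℝ 1 v₃ (Icc 0 ℓ₃))
    (hv₁neg : ∀ x ∈ Icc 0 ℓ₁, v₁ x < 0)
    (hv₂pos : ∀ x ∈ Icc 0 ℓ₂, 0 < v₂ x)
    (hv₃pos : ∀ x ∈ Icc 0 ℓ₃, 0 < v₃ x)
    (hv₁const : ∃ δ > 0, ∀ x ∈ Icc 0 δ, v₁ x = v₁ 0)
    (hv₂const : ∃ δ > 0, ∀ x ∈ Icc 0 δ, v₂ x = v₂ 0)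
    (hv₃const : ∃ δ > 0, ∀ x ∈ Icc 0 δ, v₃ x = v₃ 0)
    (hcons : h₁ ^ 2 * v₁ 0 + h₂ ^ 2 * v₂ 0 + h₃ ^ 2 * v₃ 0 = 0)
    (φ₁ φ₂ φ₃ : ℝ → ℝ → ℝ)
    (hφ₁ : ContDiffOn ℝ 1 (fun p : ℝ × ℝ => φ₁ p.1 p.2) (Icc 0 ℓ₁ ×ˢ Icc 0 T))
    (hφ₂ : ContDiffOn ℝ 1 (fun p : ℝ × ℝ => φ₂ p.1 p.2) (Icc 0 ℓ₂ ×ˢ Icc 0 T))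
    (hφ₃ : ContDiffOn ℝ 1 (fun p : ℝ × ℝ => φ₃ p.1 p.2) (Icc 0 ℓ₃ ×ˢ Icc 0 T))
    (hφ₁0 : ∃ δ > 0, ∀ t ∈ Icc 0 T,
      (∀ x ∈ Icc 0 δ, φ₁ x t = 0) ∧ (∀ x ∈ Icc (ℓ₁ - δ) ℓ₁, φ₁ x t = 0))
    (hφ₂0 : ∃ δ > 0, ∀ t ∈ Icc 0 T,
      (∀ x ∈ Icc 0 δ, φ₂ x t = 0) ∧ (∀ x ∈ Icc (ℓ₂ - δ) ℓ₂, φ₂ x t = 0))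
    (hφ₃0 : ∃ δ > 0, ∀ t ∈ Icc 0 T,
      (∀ x ∈ Icc 0 δ, φ₃ x t = 0) ∧ (∀ x ∈ Icc (ℓ₃ - δ) ℓ₃, φ₃ x t = 0)) :
    ∃ w₁ w₂ w₃ : ℝ → ℝ → ℝ,
      GraphSol ℓ₁ ℓ₂ ℓ₃ T v₁ v₂ v₃ φ₁ φ₂ φ₃ w₁ w₂ w₃ ∧
      (∀ w₁' w₂' w₃' : ℝ → ℝ → ℝ,
        GraphSol ℓ₁ ℓ₂ ℓ₃ T v₁ v₂ v₃ φ₁ φ₂ φ₃ w₁' w₂' w₃' →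
          (∀ x ∈ Icc 0 ℓ₁, ∀ t ∈ Icc 0 T, w₁' x t = w₁ x t) ∧
          (∀ x ∈ Icc 0 ℓ₂, ∀ t ∈ Icc 0 T, w₂' x t = w₂ x t) ∧
          (∀ x ∈ Icc 0 ℓ₃, ∀ t ∈ Icc 0 T, w₃' x t = w₃ x t)) ∧
      (∀ t ∈ Icc 0 T,
        v₁ 0 * h₁ ^ 2 * w₁ 0 t + v₂ 0 * h₂ ^ 2 * w₂ 0 t + v₃ 0 * h₃ ^ 2 * w₃ 0 t = 0) := by
  have hp₁ : 0 < ℓ₁ := by linarith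
  have hp₂ : 0 < ℓ₂ := by linarith
  have hp₃ : 0 < ℓ₃ := by linarith
  have hr : ∀ x ∈ Icc 0 ℓ₁, ℓ₁ - x ∈ Icc 0 ℓ₁ := fun x hx =>
    ⟨by linarith [hx.2], by linarith [hx.1]⟩
  have hv₁r : ContDiffOn ℝ 1 (fun x => -v₁ (ℓ₁ - x)) (Icc 0 ℓ₁) :=
    (hv₁.comp (contDiff_const.sub contDiff_id).contDiffOn hr).neg
  have hv₁rpos : ∀ x ∈ Icc 0 ℓ₁, 0 < -v₁ (ℓ₁ - x) := fun x hx =>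
    neg_pos.2 (hv₁neg _ (hr x hx))
  obtain ⟨δ, hδ, hφδ⟩ := hφ₁0
  obtain ⟨u, hu, hu0⟩ := exists_edgeSol (φ := fun x t => φ₁ (ℓ₁ - x) t) (β := fun _ => 0)
    hp₁ hT hv₁r hv₁rpos
    (hφ₁.comp (f := fun p : ℝ × ℝ => (ℓ₁ - p.1, p.2))
      ((contDiff_const.sub contDiff_fst).prodMk contDiff_snd).contDiffOn
      fun p hp => ⟨hr _ hp.1, hp.2⟩)
    ⟨δ, hδ, fun t ht => ⟨fun x hx => (hφδ t ht).2 _ ⟨by linarith [hx.2], by linarith [hx.1]⟩,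
      fun x hx => (hφδ t ht).1 _ ⟨by linarith [hx.2], by linarith [hx.1]⟩⟩⟩
    contDiffOn_const rfl (by simp)
  have hw₁ : EdgeSol ℓ₁ T v₁ (fun x t => -φ₁ x t) (fun x t => u (ℓ₁ - x) t) := by
    have := hu.reflect
    simpa only [sub_sub_cancel, neg_neg] using this
  have h0₁ : (0 : ℝ) ∈ Icc 0 ℓ₁ := ⟨le_rfl, hp₁.le⟩
  have hβ : ContDiffOn ℝ 1 (fun t => u (ℓ₁ - 0) t) (Icc 0 T) :=
    hw₁.1.comp (f := fun t : ℝ => ((0 : ℝ), t)) (contDiff_const.prodMk contDiff_id).contDiffOn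
      fun t ht => ⟨h0₁, ht⟩
  have hβ0 : u (ℓ₁ - 0) 0 = 0 := hw₁.2.2 0 h0₁
  have hβ0' := hw₁.derivWithin_vertex hp₁ hT
    (by simp [(hφδ 0 ⟨le_rfl, hT.le⟩).1 0 ⟨le_rfl, hδ.le⟩])
  obtain ⟨w₂, hw₂, hw₂0⟩ := exists_edgeSol hp₂ hT hv₂ hv₂pos hφ₂ hφ₂0 hβ hβ0 hβ0'
  obtain ⟨w₃, hw₃, hw₃0⟩ := exists_edgeSol hp₃ hT hv₃ hv₃pos hφ₃ hφ₃0 hβ hβ0 hβ0'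
  refine ⟨fun x t => u (ℓ₁ - x) t, w₂, w₃, ⟨hw₁, hw₂, hw₃, fun t ht => ?_, fun t ht =>
    ⟨hw₂0 t ht, hw₃0 t ht⟩⟩, ?_, fun t ht => ?_⟩
  · simpa using hu0 t ht
  · rintro w₁' w₂' w₃' ⟨g₁, g₂, g₃, gin, gvert⟩
    have heq₁ : ∀ x ∈ Icc 0 ℓ₁, ∀ t ∈ Icc 0 T, w₁' x t = u (ℓ₁ - x) t := by
      intro x hx t ht
      have := EdgeSol.eq_of_eq_inflow hp₁ hT hv₁r hv₁rpos g₁.reflect hu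
        (fun t ht => by simpa [hu0 t ht] using gin t ht) (ℓ₁ - x) (hr x hx) t ht
      simpa only [sub_sub_cancel] using this
    refine ⟨heq₁, ?_, ?_⟩
    · exact EdgeSol.eq_of_eq_inflow hp₂ hT hv₂ hv₂pos g₂ hw₂ fun t ht => by
        rw [(gvert t ht).1, heq₁ 0 h0₁ t ht, hw₂0 t ht]
    · exact EdgeSol.eq_of_eq_inflow hp₃ hT hv₃ hv₃pos g₃ hw₃ fun t ht => by
        rw [(gvert t ht).2, heq₁ 0 h0₁ t ht, hw₃0 t ht]
  · rw [hw₂0 t ht, hw₃0 t ht]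
    linear_combination u (ℓ₁ - 0) t * hcons
end

section
/- Let T > 0, and for i = 1,2,3 let ℓ_i ≥ 1, h_i > 0, and v_i ∈ C¹([0,ℓ_i]) with v₁(x) < 0 on [0,ℓ₁], v₂(x) > 0 on [0,ℓ₂], v₃(x) > 0 on [0,ℓ₃], each v_i constant on some interval [0,δ_i] with δ_i > 0, and with the conservation condition h₁² v₁(0) + h₂² v₂(0) + h₃² v₃(0) = 0. Let q₁ ∈ C¹([0,T]) with q₁(0) = 0 and q₁'(0) = 0. Then there exists exactly one triple (w₁,w₂,w₃) with w_i ∈ C¹([0,ℓ_i]×[0,T]) such that: ∂_t w_i(x,t) + ∂_x(v_i(x) w_i(x,t)) = 0 on [0,ℓ_i]×[0,T] and w_i(x,0) = 0 for all x ∈ [0,ℓ_i] (i = 1,2,3); w₁(ℓ₁,t) = q₁(t) for all t ∈ [0,T]; and the continuity condition w₂(0,t) = w₁(0,t) and w₃(0,t) = w₁(0,t) holds for all t ∈ [0,T]. Moreover this solution satisfies the Kirchhoff condition Σ_{i=1}^{3} v_i(0) h_i² w_i(0,t) = 0 for all t ∈ [0,T]. -/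
open Set

/-- `GraphSolDirichlet` collects the conditions of the limit hyperbolic problem (3.16) on
the graph with three edges: the homogeneous transport equations `∂ₜ wᵢ + ∂ₓ (vᵢ wᵢ) = 0`
with zero initial data, the inhomogeneous Dirichlet condition `w₁(ℓ₁,t) = q₁(t)` at the
inflow end of the first edge, and the continuity condition at the common vertex `x = 0`. -/
def GraphSolDirichlet (ℓ₁ ℓ₂ ℓ₃ T : ℝ) (v₁ v₂ v₃ : ℝ → ℝ) (q₁ : ℝ → ℝ)
    (w₁ w₂ w₃ : ℝ → ℝ → ℝ) : Prop :=
  EdgeSol ℓ₁ T v₁ (fun _ _ => 0) w₁ ∧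
  EdgeSol ℓ₂ T v₂ (fun _ _ => 0) w₂ ∧
  EdgeSol ℓ₃ T v₃ (fun _ _ => 0) w₃ ∧
  (∀ t ∈ Icc 0 T, w₁ ℓ₁ t = q₁ t) ∧
  (∀ t ∈ Icc 0 T, w₂ 0 t = w₁ 0 t ∧ w₃ 0 t = w₁ 0 t)

/-- A continuous function on a compact interval, extended by its boundary values, has a `C¹`
primitive on the whole line vanishing at a prescribed point. -/
theorem exists_contDiff_primitive {a b : ℝ} (hab : a ≤ b) {f : ℝ → ℝ}
    (hf : ContinuousOn f (Icc a b)) (c : ℝ) :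
    ∃ F : ℝ → ℝ, ContDiff ℝ 1 F ∧ F c = 0 ∧
      ∀ x, HasDerivAt F (f (projIcc a b hab x)) x := by
  have hg : Continuous (fun x : ℝ => f (projIcc a b hab x)) :=
    hf.comp_continuous (continuous_subtype_val.comp continuous_projIcc)
      fun x => (projIcc a b hab x).2
  have hd : ∀ x, HasDerivAt (fun x => ∫ y in c..x, f (projIcc a b hab y))
      (f (projIcc a b hab x)) x := fun x =>
    intervalIntegral.integral_hasDerivAt_right (hg.intervalIntegrable _ _)
      (hg.stronglyMeasurableAtFilter _ _) hg.continuousAt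
  refine ⟨fun x => ∫ y in c..x, f (projIcc a b hab y), ?_, intervalIntegral.integral_same, hd⟩
  rw [contDiff_one_iff_deriv]
  refine ⟨fun x => (hd x).differentiableAt, ?_⟩
  rwa [show deriv (fun x => ∫ y in c..x, f (projIcc a b hab y)) =
    fun x => f (projIcc a b hab x) from funext fun x => (hd x).deriv]

/-- A `C¹` function on `[0,T]` vanishing to first order at `0` extends to a `C¹` function on the
line vanishing on the negative half-line. -/
theorem exists_contDiff_extension_zero {T : ℝ} (hT : 0 < T) {q : ℝ → ℝ}
    (hq : ContDiffOn ℝ 1 q (Icc 0 T)) (hq0 : q 0 = 0) (hq'0 : derivWithin q (Icc 0 T) 0 = 0) :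
    ∃ Q : ℝ → ℝ, ContDiff ℝ 1 Q ∧ (∀ t ≤ 0, Q t = 0) ∧ ∀ t ∈ Icc 0 T, Q t = q t := by
  have hU := uniqueDiffOn_Icc hT
  obtain ⟨Q, hQ, hQ0, hQd⟩ := exists_contDiff_primitive hT.le
    (hq.continuousOn_derivWithin hU le_rfl) 0
  refine ⟨Q, hQ, fun t ht => ?_, fun t ht => ?_⟩
  · have key := (convex_Iic (0 : ℝ)).norm_image_sub_le_of_norm_hasDerivWithin_le (C := 0)
      (fun x _ => (hQd x).hasDerivWithinAt) (fun x hx => by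
        rw [projIcc_of_le_left hT.le hx, hq'0]; simp) self_mem_Iic ht
    rw [hQ0] at key
    simpa using key
  · have hd : ∀ x ∈ Icc 0 T, HasDerivWithinAt (fun x => Q x - q x) 0 (Icc 0 T) x := by
      intro x hx
      have h1 := (hQd x).hasDerivWithinAt (s := Icc 0 T)
      rw [projIcc_of_mem hT.le hx] at h1
      exact (h1.sub (hq.differentiableOn one_ne_zero x hx).hasDerivWithinAt).congr_deriv (sub_self _)
    have key := (convex_Icc (0 : ℝ) T).norm_image_sub_le_of_norm_hasDerivWithin_le (C := 0)
      hd (fun x _ => by simp) (left_mem_Icc.2 hT.le) ht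
    rw [hQ0, hq0] at key
    have : Q t - q t = 0 := by simpa using key
    linarith

/-- `TravelTime ℓ v a A` says that `A` is the time needed to travel along `[0,ℓ]` with velocity `v`
from the inflow end `a`. -/
structure TravelTime (ℓ : ℝ) (v : ℝ → ℝ) (a : ℝ) (A : ℝ → ℝ) : Prop where
  mem : a ∈ Icc 0 ℓ
  contDiff : ContDiff ℝ 1 A
  zero : A a = 0
  nonneg : ∀ x ∈ Icc 0 ℓ, 0 ≤ A x
  hasDerivAt : ∀ x ∈ Icc 0 ℓ, HasDerivAt A (v x)⁻¹ x
  monotone_or_antitone : Monotone A ∨ Antitone A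

theorem exists_travelTime_of_pos {ℓ : ℝ} (hℓ : 0 < ℓ) {v : ℝ → ℝ}
    (hv : ContinuousOn v (Icc 0 ℓ)) (hpos : ∀ x ∈ Icc 0 ℓ, 0 < v x) :
    ∃ A, TravelTime ℓ v 0 A := by
  obtain ⟨A, hA, hA0, hAd⟩ := exists_contDiff_primitive hℓ.le
    (hv.inv₀ fun x hx => (hpos x hx).ne') 0
  have hmono : Monotone A := monotone_of_deriv_nonneg (fun x => (hAd x).differentiableAt)
    fun x => by
      rw [(hAd x).deriv]; exact (inv_pos.2 (hpos _ (projIcc 0 ℓ hℓ.le x).2)).le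
  refine ⟨A, left_mem_Icc.2 hℓ.le, hA, hA0, fun x hx => hA0 ▸ hmono hx.1, fun x hx => ?_,
    Or.inl hmono⟩
  simpa [projIcc_of_mem hℓ.le hx] using hAd x

theorem exists_travelTime_of_neg {ℓ : ℝ} (hℓ : 0 < ℓ) {v : ℝ → ℝ}
    (hv : ContinuousOn v (Icc 0 ℓ)) (hneg : ∀ x ∈ Icc 0 ℓ, v x < 0) :
    ∃ A, TravelTime ℓ v ℓ A := by
  obtain ⟨A, hA, hA0, hAd⟩ := exists_contDiff_primitive hℓ.le
    (hv.inv₀ fun x hx => (hneg x hx).ne) ℓ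
  have hanti : Antitone A := antitone_of_deriv_nonpos (fun x => (hAd x).differentiableAt)
    fun x => by
      rw [(hAd x).deriv]; exact (inv_lt_zero.2 (hneg _ (projIcc 0 ℓ hℓ.le x).2)).le
  refine ⟨A, right_mem_Icc.2 hℓ.le, hA, hA0, fun x hx => hA0 ▸ hanti hx.2, fun x hx => ?_,
    Or.inr hanti⟩
  simpa [projIcc_of_mem hℓ.le hx] using hAd x

/-- The solution of the transport equation with inflow datum `Q` at `a`, obtained by transporting
the flux `v a * Q` along characteristics. -/
theorem TravelTime.edgeSol {ℓ T a : ℝ} {v A Q : ℝ → ℝ} (hA : TravelTime ℓ v a A)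
    (hℓ : 0 < ℓ) (hT : 0 < T) (hv : ContDiffOn ℝ 1 v (Icc 0 ℓ)) (hne : ∀ x ∈ Icc 0 ℓ, v x ≠ 0)
    (hQ : ContDiff ℝ 1 Q) (hQ0 : ∀ t ≤ 0, Q t = 0) :
    EdgeSol ℓ T v (fun _ _ => 0) (fun x t => v a * (v x)⁻¹ * Q (t - A x)) := by
  have hQd : ∀ t, HasDerivAt Q (deriv Q t) t := fun t =>
    (hQ.differentiable one_ne_zero t).hasDerivAt
  refine ⟨?_, fun x hx t ht => ?_, fun x hx => ?_⟩
  · have h1 : ContDiffOn ℝ 1 (fun p : ℝ × ℝ => (v p.1)⁻¹) (Icc 0 ℓ ×ˢ Icc 0 T) :=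
      (hv.inv hne).comp contDiff_fst.contDiffOn fun p hp => hp.1
    have h2 : ContDiff ℝ 1 (fun p : ℝ × ℝ => Q (p.2 - A p.1)) :=
      hQ.comp (contDiff_snd.sub (hA.contDiff.comp contDiff_fst))
    exact (contDiffOn_const.mul h1).mul h2.contDiffOn
  · have ht' : HasDerivWithinAt (fun τ => v a * (v x)⁻¹ * Q (τ - A x))
        (v a * (v x)⁻¹ * deriv Q (t - A x)) (Icc 0 T) t :=
      (((hQd (t - A x)).comp_sub_const t (A x)).const_mul _).hasDerivWithinAt
    have hvx := (hv.differentiableOn one_ne_zero x hx).hasDerivWithinAt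
    have hQx : HasDerivWithinAt (fun y => Q (t - A y)) (deriv Q (t - A x) * (-(v x)⁻¹))
        (Icc 0 ℓ) x :=
      ((hQd (t - A x)).comp x ((hA.hasDerivAt x hx).const_sub t)).hasDerivWithinAt
    have hx' := ((hvx.inv (hne x hx)).const_mul (v a)).mul hQx
    have hx'' : derivWithin (fun y => v a * (v y)⁻¹ * Q (t - A y)) (Icc 0 ℓ) x = _ :=
      hx'.derivWithin (uniqueDiffOn_Icc hℓ x hx)
    rw [ht'.derivWithin (uniqueDiffOn_Icc hT t ht), hx'']
    have := hne x hx
    simp only [Pi.inv_apply]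
    field_simp
    ring
  · have := hA.nonneg x hx
    simp [hQ0 (-A x) (by linarith)]

/-- The flux `v * w` is constant along the characteristics of the transport equation. -/
theorem EdgeSol.flux_eq {ℓ T a : ℝ} {v A : ℝ → ℝ} {w : ℝ → ℝ → ℝ} (hA : TravelTime ℓ v a A)
    (hℓ : 0 < ℓ) (hT : 0 < T) (hv : ContDiffOn ℝ 1 v (Icc 0 ℓ)) (hne : ∀ x ∈ Icc 0 ℓ, v x ≠ 0)
    (hw : EdgeSol ℓ T v (fun _ _ => 0) w) {c x y : ℝ} (hx : x ∈ Icc 0 ℓ) (hy : y ∈ Icc 0 ℓ)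
    (hcx : c + A x ∈ Icc 0 T) (hcy : c + A y ∈ Icc 0 T) :
    v x * w x (c + A x) = v y * w y (c + A y) := by
  obtain ⟨hw1, hw2, -⟩ := hw
  set S : Set ℝ := {z ∈ Icc 0 ℓ | c + A z ∈ Icc 0 T}
  have hS : Convex ℝ S := by
    apply OrdConnected.convex
    refine ⟨fun p hp q hq z hz => ⟨⟨hp.1.1.trans hz.1, hz.2.trans hq.1.2⟩, ?_⟩⟩
    obtain ⟨-, hp1, hp2⟩ := hp
    obtain ⟨-, hq1, hq2⟩ := hq
    rcases hA.monotone_or_antitone with h | h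
    · have h1 := h hz.1
      have h2 := h hz.2
      constructor <;> linarith
    · have h1 := h hz.1
      have h2 := h hz.2
      constructor <;> linarith
  have hd : ∀ z ∈ S, HasDerivWithinAt (fun z => v z * w z (c + A z)) 0 S z := by
    rintro z ⟨hz, hcz⟩
    have hL := (hw1.differentiableOn one_ne_zero (z, c + A z) ⟨hz, hcz⟩).hasFDerivWithinAt
    set L := fderivWithin ℝ (fun p : ℝ × ℝ => w p.1 p.2) (Icc 0 ℓ ×ˢ Icc 0 T) (z, c + A z)
    have hLx : HasDerivWithinAt (fun y => w y (c + A z)) (L (1, 0)) (Icc 0 ℓ) z :=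
      hL.comp_hasDerivWithinAt (f := fun y => (y, c + A z)) z
        ((hasDerivWithinAt_id z _).prodMk (hasDerivWithinAt_const z _ _)) fun y hy => ⟨hy, hcz⟩
    have hLt : HasDerivWithinAt (fun τ => w z τ) (L (0, 1)) (Icc 0 T) (c + A z) :=
      hL.comp_hasDerivWithinAt (f := fun τ => (z, τ)) (c + A z)
        ((hasDerivWithinAt_const _ _ _).prodMk (hasDerivWithinAt_id _ _)) fun τ hτ => ⟨hz, hτ⟩
    have hLc : HasDerivWithinAt (fun y => w y (c + A y)) (L (1, (v z)⁻¹)) S z :=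
      hL.comp_hasDerivWithinAt (f := fun y => (y, c + A y)) z
        ((hasDerivWithinAt_id z _).prodMk
          ((hA.hasDerivAt z hz).const_add c).hasDerivWithinAt) fun y hy => ⟨hy.1, hy.2⟩
    have hvz := ((hv.differentiableOn one_ne_zero z hz).hasDerivWithinAt).mono
      (fun y (hy : y ∈ S) => hy.1)
    have hpde := hw2 z hz _ hcz
    rw [hLx.derivWithin (uniqueDiffOn_Icc hℓ z hz),
      hLt.derivWithin (uniqueDiffOn_Icc hT _ hcz)] at hpde
    have hlin : L (1, (v z)⁻¹) = L (1, 0) + (v z)⁻¹ * L (0, 1) := by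
      rw [← smul_eq_mul, ← map_smul, ← map_add]; simp
    have := hvz.mul hLc
    rw [hlin] at this
    refine this.congr_deriv ?_
    have := hne z hz
    field_simp
    linarith
  have key := hS.norm_image_sub_le_of_norm_hasDerivWithin_le (C := 0) hd (fun _ _ => by simp)
    (show y ∈ S from ⟨hy, hcy⟩) (show x ∈ S from ⟨hx, hcx⟩)
  rw [zero_mul, norm_le_zero_iff, sub_eq_zero] at key
  exact key

/-- A solution of the transport equation is determined by its values at the inflow end. -/
theorem EdgeSol.eq_of_inflow_eq {ℓ T a : ℝ} {v A : ℝ → ℝ} {w w' : ℝ → ℝ → ℝ}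
    (hA : TravelTime ℓ v a A) (hℓ : 0 < ℓ) (hT : 0 < T) (hv : ContDiffOn ℝ 1 v (Icc 0 ℓ))
    (hne : ∀ x ∈ Icc 0 ℓ, v x ≠ 0) (hw : EdgeSol ℓ T v (fun _ _ => 0) w)
    (hw' : EdgeSol ℓ T v (fun _ _ => 0) w') (ha : ∀ t ∈ Icc 0 T, w a t = w' a t) :
    ∀ x ∈ Icc 0 ℓ, ∀ t ∈ Icc 0 T, w x t = w' x t := by
  intro x hx t ht
  obtain ⟨y, hy, hcy, hyw⟩ : ∃ y ∈ Icc 0 ℓ, t - A x + A y ∈ Icc 0 T ∧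
      w y (t - A x + A y) = w' y (t - A x + A y) := by
    have hAx := hA.nonneg x hx
    rcases le_total 0 (t - A x) with h | h
    · have hmem : t - A x + A a ∈ Icc 0 T := by
        rw [hA.zero]; exact ⟨by linarith, by linarith [ht.2]⟩
      exact ⟨a, hA.mem, hmem, ha _ hmem⟩
    · have hmem : A x - t ∈ uIcc (A a) (A x) := by
        rw [hA.zero, uIcc_of_le hAx]; exact ⟨by linarith, by linarith [ht.1]⟩
      obtain ⟨y, hy, hyA⟩ := intermediate_value_uIcc hA.contDiff.continuous.continuousOn hmem
      have hy' : y ∈ Icc 0 ℓ := uIcc_subset_Icc hA.mem hx hy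
      have h0 : t - A x + A y = 0 := by rw [hyA]; ring
      refine ⟨y, hy', ?_, ?_⟩
      · rw [h0]; exact left_mem_Icc.2 hT.le
      · rw [h0, hw.2.2 y hy', hw'.2.2 y hy']
  have hcx : t - A x + A x ∈ Icc 0 T := by simpa using ht
  have h1 := hw.flux_eq hA hℓ hT hv hne hx hy hcx hcy
  have h2 := hw'.flux_eq hA hℓ hT hv hne hx hy hcx hcy
  rw [hyw, ← h2, sub_add_cancel] at h1
  exact mul_left_cancel₀ (hne x hx) h1

/-- Unique classical solvability of the limit hyperbolic problem (3.16) on the graph with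
inhomogeneous Dirichlet datum `q₁`, together with the Kirchhoff condition at the vertex. -/
theorem graph_transport_dirichlet_wellposed
    (T : ℝ) (hT : 0 < T)
    (ℓ₁ ℓ₂ ℓ₃ : ℝ) (hℓ₁ : 1 ≤ ℓ₁) (hℓ₂ : 1 ≤ ℓ₂) (hℓ₃ : 1 ≤ ℓ₃)
    (h₁ h₂ h₃ : ℝ) (hh₁ : 0 < h₁) (hh₂ : 0 < h₂) (hh₃ : 0 < h₃)
    (v₁ v₂ v₃ : ℝ → ℝ)
    (hv₁ : ContDiffOn ℝ 1 v₁ (Icc 0 ℓ₁))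
    (hv₂ : ContDiffOn ℝ 1 v₂ (Icc 0 ℓ₂))
    (hv₃ : ContDiffOn ℝ 1 v₃ (Icc 0 ℓ₃))
    (hv₁neg : ∀ x ∈ Icc 0 ℓ₁, v₁ x < 0)
    (hv₂pos : ∀ x ∈ Icc 0 ℓ₂, 0 < v₂ x)
    (hv₃pos : ∀ x ∈ Icc 0 ℓ₃, 0 < v₃ x)
    (hv₁const : ∃ δ > 0, ∀ x ∈ Icc 0 δ, v₁ x = v₁ 0)
    (hv₂const : ∃ δ > 0, ∀ x ∈ Icc 0 δ, v₂ x = v₂ 0)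
    (hv₃const : ∃ δ > 0, ∀ x ∈ Icc 0 δ, v₃ x = v₃ 0)
    (hcons : h₁ ^ 2 * v₁ 0 + h₂ ^ 2 * v₂ 0 + h₃ ^ 2 * v₃ 0 = 0)
    (q₁ : ℝ → ℝ) (hq₁ : ContDiffOn ℝ 1 q₁ (Icc 0 T))
    (hq₁0 : q₁ 0 = 0) (hq₁'0 : derivWithin q₁ (Icc 0 T) 0 = 0) :
    ∃ w₁ w₂ w₃ : ℝ → ℝ → ℝ,
      GraphSolDirichlet ℓ₁ ℓ₂ ℓ₃ T v₁ v₂ v₃ q₁ w₁ w₂ w₃ ∧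
      (∀ w₁' w₂' w₃' : ℝ → ℝ → ℝ,
        GraphSolDirichlet ℓ₁ ℓ₂ ℓ₃ T v₁ v₂ v₃ q₁ w₁' w₂' w₃' →
          (∀ x ∈ Icc 0 ℓ₁, ∀ t ∈ Icc 0 T, w₁' x t = w₁ x t) ∧
          (∀ x ∈ Icc 0 ℓ₂, ∀ t ∈ Icc 0 T, w₂' x t = w₂ x t) ∧
          (∀ x ∈ Icc 0 ℓ₃, ∀ t ∈ Icc 0 T, w₃' x t = w₃ x t)) ∧
      (∀ t ∈ Icc 0 T,
        v₁ 0 * h₁ ^ 2 * w₁ 0 t + v₂ 0 * h₂ ^ 2 * w₂ 0 t + v₃ 0 * h₃ ^ 2 * w₃ 0 t = 0) := by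
  have hl₁ : 0 < ℓ₁ := by linarith
  have hl₂ : 0 < ℓ₂ := by linarith
  have hl₃ : 0 < ℓ₃ := by linarith
  have hne₁ : ∀ x ∈ Icc 0 ℓ₁, v₁ x ≠ 0 := fun x hx => (hv₁neg x hx).ne
  have hne₂ : ∀ x ∈ Icc 0 ℓ₂, v₂ x ≠ 0 := fun x hx => (hv₂pos x hx).ne'
  have hne₃ : ∀ x ∈ Icc 0 ℓ₃, v₃ x ≠ 0 := fun x hx => (hv₃pos x hx).ne'
  obtain ⟨A₁, hA₁⟩ := exists_travelTime_of_neg hl₁ hv₁.continuousOn hv₁neg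
  obtain ⟨A₂, hA₂⟩ := exists_travelTime_of_pos hl₂ hv₂.continuousOn hv₂pos
  obtain ⟨A₃, hA₃⟩ := exists_travelTime_of_pos hl₃ hv₃.continuousOn hv₃pos
  obtain ⟨Q, hQ, hQ0, hQq⟩ := exists_contDiff_extension_zero hT hq₁ hq₁0 hq₁'0
  set R : ℝ → ℝ := fun t => v₁ ℓ₁ * (v₁ 0)⁻¹ * Q (t - A₁ 0) with hR_def
  have hR : ContDiff ℝ 1 R := contDiff_const.mul (hQ.comp (contDiff_id.sub contDiff_const))
  have hR0 : ∀ t ≤ 0, R t = 0 := fun t ht => by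
    have := hA₁.nonneg 0 (left_mem_Icc.2 hl₁.le)
    simp [hR_def, hQ0 (t - A₁ 0) (by linarith)]
  have hw₁ := hA₁.edgeSol hl₁ hT hv₁ hne₁ hQ hQ0
  have hw₂ := hA₂.edgeSol hl₂ hT hv₂ hne₂ hR hR0
  have hw₃ := hA₃.edgeSol hl₃ hT hv₃ hne₃ hR hR0
  have hin₁ : ∀ t ∈ Icc 0 T, v₁ ℓ₁ * (v₁ ℓ₁)⁻¹ * Q (t - A₁ ℓ₁) = q₁ t := fun t ht => by
    rw [hA₁.zero, mul_inv_cancel₀ (hne₁ _ hA₁.mem), sub_zero, one_mul, hQq t ht]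
  have hin₂ : ∀ t, v₂ 0 * (v₂ 0)⁻¹ * R (t - A₂ 0) = R t := fun t => by
    rw [hA₂.zero, mul_inv_cancel₀ (hne₂ _ hA₂.mem), sub_zero, one_mul]
  have hin₃ : ∀ t, v₃ 0 * (v₃ 0)⁻¹ * R (t - A₃ 0) = R t := fun t => by
    rw [hA₃.zero, mul_inv_cancel₀ (hne₃ _ hA₃.mem), sub_zero, one_mul]
  refine ⟨_, _, _, ⟨hw₁, hw₂, hw₃, hin₁, fun t _ => ⟨hin₂ t, hin₃ t⟩⟩, ?_, fun t _ => ?_⟩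
  · rintro w₁' w₂' w₃' ⟨hw₁', hw₂', hw₃', hin', hvertex⟩
    have heq₁ := hw₁'.eq_of_inflow_eq hA₁ hl₁ hT hv₁ hne₁ hw₁ fun t ht => by
      rw [hin' t ht, hin₁ t ht]
    have h0 := heq₁ 0 (left_mem_Icc.2 hl₁.le)
    exact ⟨heq₁,
      hw₂'.eq_of_inflow_eq hA₂ hl₂ hT hv₂ hne₂ hw₂ fun t ht => by
        rw [(hvertex t ht).1, h0 t ht, hin₂ t],
      hw₃'.eq_of_inflow_eq hA₃ hl₃ hT hv₃ hne₃ hw₃ fun t ht => by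
        rw [(hvertex t ht).2, h0 t ht, hin₃ t]⟩
  · simp only [hin₂, hin₃]
    change v₁ 0 * h₁ ^ 2 * R t + _ + _ = 0
    linear_combination R t * hcons
end

section
/- Let v ∈ ℝ, K ∈ ℕ, and let (w_m)_{m=−2}^{K} be C^∞ functions ℝ² → ℝ with w_{−2} ≡ 0 and w_{−1} ≡ 0, satisfying for every m ∈ {0,…,K} and every (x,t) ∈ ℝ² the recursion ∂_t w_m(x,t) + v ∂_x w_m(x,t) = ∂_x² w_{m−1}(x,t). For k ≥ −1 define Ψ_k(ξ,t) := Σ_{j=1}^{k+1} (ξ^j / j!) (∂_x^j w_{k−j})(0,t) (so Ψ_{−1} ≡ 0, the sum being empty). Then for every k ∈ {0,…,K} and all (ξ,t) ∈ ℝ²: ∂_ξ² Ψ_k(ξ,t) − v ∂_ξ Ψ_k(ξ,t) = ∂_t w_{k−1}(0,t) + ∂_t Ψ_{k−1}(ξ,t). -/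
/-- The polynomial part `Ψ_k(ξ,t) = Σ_{j=1}^{k+1} (ξ^j / j!) ∂ₓ^j w_{k-j}(0,t)` (formula
(3.13) of the paper) of the prescribed growth at infinity of the node-layer coefficients.
For `k = -1` the sum is empty, so `Ψ_{-1} ≡ 0`. -/
noncomputable def Psi (w : ℤ → ℝ → ℝ → ℝ) (k : ℤ) (ξ t : ℝ) : ℝ :=
  ∑ j ∈ Finset.Icc 1 (k + 1).toNat,
    ξ ^ j / (Nat.factorial j : ℝ) * iteratedDeriv j (fun y => w (k - (j : ℤ)) y t) 0

open scoped ContDiff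

/-- The directional derivative of a smooth function is smooth. -/
theorem contDiff_fderiv_apply_const {F : ℝ × ℝ → ℝ} (hF : ContDiff ℝ ∞ F) (u : ℝ × ℝ) :
    ContDiff ℝ ∞ (fun p => fderiv ℝ F p u) :=
  (hF.fderiv_right (m := ∞) (by simp)).clm_apply contDiff_const

/-- Directional derivatives of a smooth function commute. -/
theorem fderiv_fderiv_apply_comm {F : ℝ × ℝ → ℝ} (hF : ContDiff ℝ ∞ F) (u u' p : ℝ × ℝ) :
    fderiv ℝ (fun q => fderiv ℝ F q u) p u' = fderiv ℝ (fun q => fderiv ℝ F q u') p u := by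
  have hd : DifferentiableAt ℝ (fderiv ℝ F) p :=
    (hF.fderiv_right (m := ∞) (by simp)).differentiable (by simp) p
  have hs : IsSymmSndFDerivAt ℝ F p :=
    hF.contDiffAt.isSymmSndFDerivAt
      (by simpa using WithTop.coe_le_coe.mpr (le_top : (2 : ℕ∞) ≤ ⊤))
  rw [fderiv_clm_apply hd (differentiableAt_const u),
    fderiv_clm_apply hd (differentiableAt_const u')]
  simpa using hs u' u

theorem hasDerivAt_slice_fst {F : ℝ × ℝ → ℝ} (hF : ContDiff ℝ ∞ F) (x t : ℝ) :
    HasDerivAt (fun y => F (y, t)) (fderiv ℝ F (x, t) (1, 0)) x :=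
  (hF.differentiable (by simp) (x, t)).hasFDerivAt.comp_hasDerivAt x
    ((hasDerivAt_id x).prodMk (hasDerivAt_const x t))

theorem hasDerivAt_slice_snd {F : ℝ × ℝ → ℝ} (hF : ContDiff ℝ ∞ F) (x t : ℝ) :
    HasDerivAt (fun τ => F (x, τ)) (fderiv ℝ F (x, t) (0, 1)) t :=
  (hF.differentiable (by simp) (x, t)).hasFDerivAt.comp_hasDerivAt t
    ((hasDerivAt_const t x).prodMk (hasDerivAt_id t))

/-- Iterated derivatives in the first variable commute with the derivative in the second. -/
theorem hasDerivAt_iteratedDeriv_slice (i : ℕ) {F : ℝ × ℝ → ℝ} (hF : ContDiff ℝ ∞ F)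
    (x t : ℝ) :
    HasDerivAt (fun τ => iteratedDeriv i (fun y => F (y, τ)) x)
      (iteratedDeriv i (fun y => deriv (fun τ => F (y, τ)) t) x) t := by
  induction i generalizing F with
  | zero =>
    simpa only [iteratedDeriv_zero, (hasDerivAt_slice_snd hF x t).deriv] using
      hasDerivAt_slice_snd hF x t
  | succ i ih =>
    have hx := contDiff_fderiv_apply_const hF (1, 0)
    have ht := contDiff_fderiv_apply_const hF (0, 1)
    have h1 : ∀ τ, deriv (fun y => F (y, τ)) = fun y => fderiv ℝ F (y, τ) (1, 0) :=
      fun τ => funext fun y => (hasDerivAt_slice_fst hF y τ).deriv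
    have h2 : deriv (fun y => deriv (fun τ => F (y, τ)) t)
        = fun y => deriv (fun τ => fderiv ℝ F (y, τ) (1, 0)) t := by
      have h3 : (fun y => deriv (fun τ => F (y, τ)) t) = fun y => fderiv ℝ F (y, t) (0, 1) :=
        funext fun y => (hasDerivAt_slice_snd hF y t).deriv
      rw [h3]
      funext y
      rw [(hasDerivAt_slice_fst ht y t).deriv, (hasDerivAt_slice_snd hx y t).deriv,
        fderiv_fderiv_apply_comm hF]
    simp only [iteratedDeriv_succ', h1, h2]
    exact ih hx

theorem hasDerivAt_pow_succ_div_factorial (i : ℕ) (ξ : ℝ) :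
    HasDerivAt (fun η : ℝ => η ^ (i + 1) / ((i + 1).factorial : ℝ))
      (ξ ^ i / (i.factorial : ℝ)) ξ := by
  refine ((hasDerivAt_pow (i + 1) ξ).div_const _).congr_deriv ?_
  have h : (i.factorial : ℝ) ≠ 0 := by positivity
  rw [Nat.factorial_succ]
  push_cast
  field_simp

theorem hasDerivAt_sum_pow_succ_div_factorial (N : ℕ) (c : ℕ → ℝ) (ξ : ℝ) :
    HasDerivAt
      (fun η : ℝ => ∑ i ∈ Finset.range N, η ^ (i + 1) / ((i + 1).factorial : ℝ) * c i)
      (∑ i ∈ Finset.range N, ξ ^ i / (i.factorial : ℝ) * c i) ξ :=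
  HasDerivAt.fun_sum fun i _ => (hasDerivAt_pow_succ_div_factorial i ξ).mul_const (c i)

theorem Psi_eq_sum_range (w : ℤ → ℝ → ℝ → ℝ) (N : ℕ) (k : ℤ) (hk : k + 1 = N) (ξ t : ℝ) :
    Psi w k ξ t = ∑ i ∈ Finset.range N, ξ ^ (i + 1) / ((i + 1).factorial : ℝ) *
      iteratedDeriv (i + 1) (fun y => w (k - 1 - i) y t) 0 := by
  rw [Psi, hk, Int.toNat_natCast, Finset.range_eq_Ico]
  refine (Finset.sum_Ico_add' (fun j : ℕ => ξ ^ j / (j.factorial : ℝ) *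
    iteratedDeriv j (fun y => w (k - (j : ℤ)) y t) 0) 0 N 1).symm.trans ?_
  refine Finset.sum_congr rfl fun i _ => ?_
  rw [show k - ((i + 1 : ℕ) : ℤ) = k - 1 - i by push_cast; ring]

/-- If the C^∞ coefficients `w_m` (with `w_{-2} ≡ w_{-1} ≡ 0`) satisfy the recursive
transport equations `∂ₜ w_m + v ∂ₓ w_m = ∂ₓ² w_{m-1}` for `0 ≤ m ≤ K`, then the
polynomial parts `Ψ_k` satisfy
`∂_ξ² Ψ_k − v ∂_ξ Ψ_k = ∂ₜ w_{k-1}(0,t) + ∂ₜ Ψ_{k-1}(ξ,t)` for `0 ≤ k ≤ K`. -/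
theorem psi_identity
    (v : ℝ) (K : ℕ) (w : ℤ → ℝ → ℝ → ℝ)
    (hw : ∀ m : ℤ, ContDiff ℝ (⊤ : ℕ∞) (fun p : ℝ × ℝ => w m p.1 p.2))
    (hm2 : ∀ x t : ℝ, w (-2) x t = 0)
    (hm1 : ∀ x t : ℝ, w (-1) x t = 0)
    (hrec : ∀ m : ℤ, 0 ≤ m → m ≤ (K : ℤ) → ∀ x t : ℝ,
      deriv (fun τ => w m x τ) t + v * deriv (fun y => w m y t) x
        = iteratedDeriv 2 (fun y => w (m - 1) y t) x) :
    ∀ k : ℤ, 0 ≤ k → k ≤ (K : ℤ) → ∀ ξ t : ℝ,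
      iteratedDeriv 2 (fun η => Psi w k η t) ξ - v * deriv (fun η => Psi w k η t) ξ
        = deriv (fun τ => w (k - 1) 0 τ) t + deriv (fun τ => Psi w (k - 1) ξ τ) t := by
  intro k hk0 hkK ξ t
  obtain ⟨n, rfl⟩ := Int.eq_ofNat_of_zero_le hk0
  have hslice : ∀ m : ℤ, ContDiff ℝ ∞ (fun y => w m y t) := fun m =>
    (hw m).comp (contDiff_id.prodMk contDiff_const)
  have hder : ∀ (i : ℕ) (m : ℤ), -1 ≤ m → m ≤ K →
      HasDerivAt (fun τ => iteratedDeriv i (fun y => w m y τ) 0)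
        (iteratedDeriv (i + 2) (fun y => w (m - 1) y t) 0
          - v * iteratedDeriv (i + 1) (fun y => w m y t) 0) t := by
    intro i m hm hmK
    refine (hasDerivAt_iteratedDeriv_slice i (hw m) 0 t).congr_deriv ?_
    have hpde : (fun y => deriv (fun τ => w m y τ) t)
        = fun y => iteratedDeriv 2 (fun y => w (m - 1) y t) y
          - v * deriv (fun y => w m y t) y := by
      funext y
      rcases hm.eq_or_lt with rfl | hm
      · norm_num [hm1, hm2]
      · exact eq_sub_of_add_eq (hrec m (by lia) hmK y t)
    have hi : (i : WithTop ℕ∞) ≤ ∞ := WithTop.coe_le_coe.mpr (le_top : (i : ℕ∞) ≤ ⊤)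
    have hA : ContDiff ℝ i (iteratedDeriv 2 (fun y => w (m - 1) y t)) := by
      simpa only [iteratedDeriv_eq_iterate] using ((hslice (m - 1)).iterate_deriv 2).of_le hi
    have hB : ContDiff ℝ i (deriv (fun y => w m y t)) := ((hslice m).iterate_deriv 1).of_le hi
    rw [hpde, iteratedDeriv_fun_sub hA.contDiffAt (contDiff_const.mul hB).contDiffAt,
      iteratedDeriv_const_mul_field, iteratedDeriv_succ' (n := i)]
    simp only [iteratedDeriv_eq_iterate, Function.iterate_add_apply]
  set c : ℕ → ℝ := fun i => iteratedDeriv (i + 1) (fun y => w (n - 1 - i) y t) 0 with hc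
  have hPsi : (fun η => Psi w n η t) = fun η => ∑ i ∈ Finset.range (n + 1),
      η ^ (i + 1) / ((i + 1).factorial : ℝ) * c i :=
    funext fun η => Psi_eq_sum_range w (n + 1) n (by simp) η t
  have hd1 : deriv (fun η => Psi w n η t) = fun η => ∑ i ∈ Finset.range (n + 1),
      η ^ i / (i.factorial : ℝ) * c i := by
    rw [hPsi]
    exact funext fun η => (hasDerivAt_sum_pow_succ_div_factorial (n + 1) c η).deriv
  have hd2 : iteratedDeriv 2 (fun η => Psi w n η t) ξ
      = ∑ i ∈ Finset.range n, ξ ^ i / (i.factorial : ℝ) * c (i + 1) := by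
    rw [iteratedDeriv_succ', iteratedDeriv_one, hd1]
    simp only [Finset.sum_range_succ' _ n, pow_zero]
    exact ((hasDerivAt_sum_pow_succ_div_factorial n (fun i => c (i + 1)) ξ).add_const
      _).deriv
  have hlast : c (n + 1) = 0 := by
    simp only [hc]
    rw [show (n : ℤ) - 1 - ((n + 1 : ℕ) : ℤ) = -2 by push_cast; ring]
    simp [hm2]
  have hd2' : iteratedDeriv 2 (fun η => Psi w n η t) ξ
      = ∑ i ∈ Finset.range (n + 1), ξ ^ i / (i.factorial : ℝ) * c (i + 1) := by
    rw [Finset.sum_range_succ, hlast, hd2, mul_zero, add_zero]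
  have hc' : ∀ i : ℕ, i ≤ n →
      HasDerivAt (fun τ => iteratedDeriv i (fun y => w (n - 1 - i) y τ) 0)
        (c (i + 1) - v * c i) t := by
    intro i hi
    have h := hder i (n - 1 - i) (by lia) (by lia)
    simp only [hc]
    rwa [show (n : ℤ) - 1 - ((i + 1 : ℕ) : ℤ) = n - 1 - i - 1 by push_cast; ring]
  have h0 : deriv (fun τ => w (n - 1) 0 τ) t = c 1 - v * c 0 := by
    simpa using (hc' 0 (Nat.zero_le n)).deriv
  have hPsi' : (fun τ => Psi w (n - 1) ξ τ) = fun τ => ∑ i ∈ Finset.range n,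
      ξ ^ (i + 1) / ((i + 1).factorial : ℝ) *
        iteratedDeriv (i + 1) (fun y => w (n - 1 - (i + 1 : ℕ)) y τ) 0 := by
    funext τ
    rw [Psi_eq_sum_range w n (n - 1) (by ring)]
    refine Finset.sum_congr rfl fun i _ => ?_
    rw [show (n : ℤ) - 1 - ((i + 1 : ℕ) : ℤ) = n - 1 - 1 - i by push_cast; ring]
  have ht : deriv (fun τ => Psi w (n - 1) ξ τ) t = ∑ i ∈ Finset.range n,
      ξ ^ (i + 1) / ((i + 1).factorial : ℝ) * (c (i + 1 + 1) - v * c (i + 1)) := by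
    rw [hPsi']
    exact (HasDerivAt.fun_sum fun i hi =>
      (hc' (i + 1) (Finset.mem_range.mp hi)).const_mul _).deriv
  rw [hd2', hd1, h0, ht, Finset.mul_sum, ← Finset.sum_sub_distrib, Finset.sum_range_succ',
    add_comm]
  congr 1
  · simp
  · exact Finset.sum_congr rfl fun i _ => by ring
end

section
/- Let v > 0 and let Φ_a, Φ_b : ℝ → ℝ with Φ_b continuously differentiable. Define Π_b(η,t) := Φ_b(t)·exp(−v η) and Π_a(η,t) := (Φ_a(t) − (Φ_b'(t)/v)·η)·exp(−v η). Then for all η ∈ ℝ and t ∈ ℝ: ∂_η² Π_a(η,t) + v ∂_η Π_a(η,t) = ∂_t Π_b(η,t); moreover Π_a(0,t) = Φ_a(t) for all t, and for each fixed t, Π_a(η,t) → 0 as η → +∞. -/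
/-- The boundary-layer coefficient `Π_b(η,t) = Φ_b(t)·e^{−vη}` (the previously
constructed term of the boundary-layer expansion). -/
noncomputable def Pib (v : ℝ) (Φb : ℝ → ℝ) (η t : ℝ) : ℝ :=
  Φb t * Real.exp (-v * η)

/-- The next boundary-layer coefficient
`Π_a(η,t) = (Φ_a(t) − (Φ_b'(t)/v)·η)·e^{−vη}` (formula (3.37) of the paper). -/
noncomputable def Pia (v : ℝ) (Φa Φb : ℝ → ℝ) (η t : ℝ) : ℝ :=
  (Φa t - deriv Φb t / v * η) * Real.exp (-v * η)

/-- The derivative of an affine function times `e^{−vη}` is again of this form. -/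
lemma hasDerivAt_affine_mul_exp (v A B y : ℝ) :
    HasDerivAt (fun y => (A - B * y) * Real.exp (-v * y))
      ((-B - v * A - -(v * B) * y) * Real.exp (-v * y)) y := by
  have h_affine : HasDerivAt (fun y => A - B * y) (-B) y := by
    simpa using ((hasDerivAt_id y).const_mul B).const_sub A
  have h_exp : HasDerivAt (fun y => Real.exp (-v * y)) (Real.exp (-v * y) * -v) y := by
    simpa using ((hasDerivAt_id y).const_mul (-v)).exp
  exact (h_affine.mul h_exp).congr_deriv (by ring)

lemma deriv_affine_mul_exp (v A B : ℝ) :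
    deriv (fun y => (A - B * y) * Real.exp (-v * y)) =
      fun y => (-B - v * A - -(v * B) * y) * Real.exp (-v * y) :=
  funext fun y => (hasDerivAt_affine_mul_exp v A B y).deriv

lemma tendsto_affine_mul_exp_atTop {v : ℝ} (hv : 0 < v) (A B : ℝ) :
    Filter.Tendsto (fun y => (A - B * y) * Real.exp (-v * y)) Filter.atTop (nhds 0) := by
  have h_scale : Filter.Tendsto (fun y : ℝ => v * y) Filter.atTop Filter.atTop :=
    Filter.tendsto_id.const_mul_atTop hv
  have h_zero := (Real.tendsto_pow_mul_exp_neg_atTop_nhds_zero 0).comp h_scale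
  have h_one := (Real.tendsto_pow_mul_exp_neg_atTop_nhds_zero 1).comp h_scale
  have h_comb := (h_zero.const_mul A).sub (h_one.const_mul (B / v))
  simp only [mul_zero, sub_zero] at h_comb
  refine h_comb.congr fun y => ?_
  simp only [Function.comp_apply, pow_zero, pow_one, neg_mul]
  field_simp

/-- Verification of the explicit second-order boundary-layer solution (3.37):
`Π_a` solves `∂²_η Π_a + v ∂_η Π_a = ∂_t Π_b`, has boundary value `Φ_a(t)` at `η = 0`,
and decays to `0` as `η → +∞` for each fixed `t`. -/
theorem boundary_layer_second_order
    (v : ℝ) (hv : 0 < v) (Φa Φb : ℝ → ℝ) (hΦb : ContDiff ℝ 1 Φb) :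
    (∀ η t : ℝ,
      deriv (fun y => deriv (fun y' => Pia v Φa Φb y' t) y) η
        + v * deriv (fun y => Pia v Φa Φb y t) η
        = deriv (fun τ => Pib v Φb η τ) t) ∧
    (∀ t : ℝ, Pia v Φa Φb 0 t = Φa t) ∧
    (∀ t : ℝ, Filter.Tendsto (fun η => Pia v Φa Φb η t) Filter.atTop (nhds 0)) := by
  refine ⟨fun η t => ?_, fun t => by simp [Pia], fun t => tendsto_affine_mul_exp_atTop hv _ _⟩
  have h_diff : DifferentiableAt ℝ Φb t := hΦb.differentiable one_ne_zero t
  simp only [Pia, Pib]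
  rw [deriv_mul_const h_diff, deriv_affine_mul_exp, deriv_affine_mul_exp]
  field_simp
  ring
end
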